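/- arXiv:2211.01590 — 2 statements merged into one kernel-verified Lean document; each statement's English description precedes it below -/
import Mathlib

section
/- (1-type irrationality, logarithmic Hölder case) Let T be an orientation-preserving circle diffeomorphism with irrational rotation number ρ = [k₁,k₂,…] such that all partial quotients lie in a finite set {K₁,…,K_ν} of distinct positive integers (ν ≥ 2) and, for each j, lim_{N→∞} #{1 ≤ n ≤ N : kₙ = K_j}/N = p_j ∈ (0,1) with Σ_{j=1}^{ν} p_j = 1. Suppose F is C² with F′ > 0 and there are σ > 0 and c₀ > 0 such that |F″(x) − F″(y)| ≤ c₀ (log(1/|x − y|))^{−1−σ} whenever 0 < |x − y| ≤ 1/2. Then T admits a C¹ conjugacy Φ to R_ρ whose derivative has a logarithmic Hölder modulus: there is C > 0 with |Φ′(x) − Φ′(y)| ≤ C (log(1/|x − y|))^{−σ} for all x,y with 0 < |x − y| ≤ 1/2. -/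
namespace CircleReturns

open Set Filter Topology

/-- The signed displacement `(-1)ⁿ (F^{qₙ}(x) - pₙ - x)` of the `n`-th closest return. -/
noncomputable def gap (F : ℝ → ℝ) (p q : ℕ → ℕ) (n : ℕ) (x : ℝ) : ℝ :=
  (-1) ^ n * (F^[q n] x - p n - x)

/-- The `n`-th closest return map `x ↦ F^{qₙ}(x) - pₙ`. -/
noncomputable def ret (F : ℝ → ℝ) (p q : ℕ → ℕ) (n : ℕ) (x : ℝ) : ℝ := F^[q n] x - p n

/-- A lift of a circle homeomorphism whose closest returns alternate in sign, as prescribed by a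
continued fraction with partial quotients `k` and convergents `p / q`. -/
structure IsReturns (F : ℝ → ℝ) (k p q : ℕ → ℕ) : Prop where
  mono : StrictMono F
  deg : ∀ x, F (x + 1) = F x + 1
  one_le_k : ∀ n, 1 ≤ k (n + 1)
  p0 : p 0 = 0
  p1 : p 1 = 1
  q0 : q 0 = 1
  q1 : q 1 = k 1
  prec : ∀ n, p (n + 2) = k (n + 2) * p (n + 1) + p n
  qrec : ∀ n, q (n + 2) = k (n + 2) * q (n + 1) + q n
  gap_pos : ∀ n x, 0 < gap F p q n x

lemma convergents_det {k p q : ℕ → ℕ} (hp0 : p 0 = 0) (hp1 : p 1 = 1) (hq0 : q 0 = 1)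
    (hprec : ∀ n, p (n + 2) = k (n + 2) * p (n + 1) + p n)
    (hqrec : ∀ n, q (n + 2) = k (n + 2) * q (n + 1) + q n) (n : ℕ) :
    (p (n + 1) : ℝ) * q n - p n * q (n + 1) = (-1) ^ n := by
  induction n with
  | zero => simp [hp0, hp1, hq0]
  | succ n ih =>
    rw [hprec, hqrec, pow_succ, ← ih]
    push_cast
    ring

lemma iterate_add_nat {F : ℝ → ℝ} (hdeg : ∀ x, F (x + 1) = F x + 1) (i m : ℕ) (x : ℝ) :
    F^[i] (x + m) = F^[i] x + m := by
  have h1 : ∀ i x, F^[i] (x + 1) = F^[i] x + 1 := by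
    intro i
    induction i with
    | zero => simp
    | succ i ih => intro x; simp [Function.iterate_succ_apply, hdeg, ih]
  induction m with
  | zero => simp
  | succ m ih => push_cast; rw [← add_assoc, h1, ih, add_assoc]

lemma iterate_sub_nat {F : ℝ → ℝ} (hdeg : ∀ x, F (x + 1) = F x + 1) (i m : ℕ) (x : ℝ) :
    F^[i] (x - m) = F^[i] x - m := by
  have := iterate_add_nat hdeg i m (x - m)
  rw [sub_add_cancel] at this
  linarith

lemma periodic_sub_nat {u : ℝ → ℝ} (hu : ∀ x, u (x + 1) = u x) (m : ℕ) (x : ℝ) :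
    u (x - m) = u x := by
  have : Function.Periodic u 1 := hu
  simpa using this.sub_nat_mul_eq m (x := x)

lemma q_pos {k q : ℕ → ℕ} (hk : ∀ n, 1 ≤ k (n + 1)) (hq0 : q 0 = 1) (hq1 : q 1 = k 1)
    (hqrec : ∀ n, q (n + 2) = k (n + 2) * q (n + 1) + q n) (n : ℕ) : 0 < q n := by
  induction n using Nat.twoStepInduction with
  | zero => simp [hq0]
  | one => rw [hq1]; exact hk 0
  | more n h0 h1 => rw [hqrec]; omega

lemma sum_range_shift_comm (f : ℕ → ℝ) (a b : ℕ) :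
    ∑ i ∈ Finset.range a, (f (b + i) - f i) = ∑ i ∈ Finset.range b, (f (a + i) - f i) := by
  have h1 := Finset.sum_range_add f a b
  have h2 := Finset.sum_range_add f b a
  rw [add_comm b a] at h2
  simp only [Finset.sum_sub_distrib]
  linarith

namespace IsReturns

variable {F : ℝ → ℝ} {k p q : ℕ → ℕ} (h : IsReturns F k p q)

include h

lemma one_le_q (n : ℕ) : 1 ≤ q n := q_pos h.one_le_k h.q0 h.q1 h.qrec n

lemma q_le_succ (n : ℕ) : q n ≤ q (n + 1) := by
  match n with
  | 0 => rw [h.q0]; exact h.one_le_q 1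
  | n + 1 =>
    rw [h.qrec]
    exact (Nat.le_mul_of_pos_left _ (h.one_le_k (n + 1))).trans (Nat.le_add_right _ _)

lemma ret_iterate (n i : ℕ) (x : ℝ) :
    F^[i] (ret F p q n x) = ret F p q n (F^[i] x) := by
  unfold ret
  rw [iterate_sub_nat h.deg, ← Function.iterate_add_apply, ← Function.iterate_add_apply,
    add_comm]

omit h in
lemma ret_sub (n : ℕ) (x : ℝ) : ret F p q n x - x = (-1) ^ n * gap F p q n x := by
  unfold ret gap
  rw [← mul_assoc, ← mul_pow]
  norm_num

lemma abs_ret_sub (n : ℕ) (x : ℝ) : |ret F p q n x - x| = gap F p q n x := by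
  rw [ret_sub, abs_mul, abs_pow, abs_neg, abs_one, one_pow, one_mul, abs_of_pos (h.gap_pos n x)]

omit h in
lemma displacement (n j : ℕ) (x : ℝ) :
    F^[q n + j * q (n + 1)] x - (p n + j * p (n + 1) : ℕ) - x = (-1) ^ n *
      (gap F p q n x - ∑ i ∈ Finset.range j, gap F p q (n + 1) (F^[q n + i * q (n + 1)] x)) := by
  induction j with
  | zero =>
    have := ret_sub (F := F) (p := p) (q := q) n x
    simp only [ret] at this
    simp [← this]
  | succ j ih =>
    have := ret_sub (F := F) (p := p) (q := q) (n + 1) (F^[q n + j * q (n + 1)] x)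
    simp only [ret] at this
    rw [← Function.iterate_add_apply] at this
    rw [Finset.sum_range_succ, show q n + (j + 1) * q (n + 1) = q (n + 1) + (q n + j * q (n + 1))
      by ring]
    rw [pow_succ] at this
    push_cast at ih ⊢
    linarith

lemma gap_eq (n : ℕ) (x : ℝ) :
    gap F p q n x = gap F p q (n + 2) x +
      ∑ i ∈ Finset.range (k (n + 2)), gap F p q (n + 1) (F^[q n + i * q (n + 1)] x) := by
  have h1 := displacement (F := F) (p := p) (q := q) n (k (n + 2)) x
  have h2 : gap F p q (n + 2) x = (-1) ^ n * (F^[q n + k (n + 2) * q (n + 1)] x -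
      (p n + k (n + 2) * p (n + 1) : ℕ) - x) := by
    unfold gap
    rw [h.qrec, h.prec, pow_add]
    simp [add_comm]
  rw [h2, h1, ← mul_assoc, ← mul_pow]
  norm_num

lemma gap_total (n : ℕ) (x : ℝ) :
    ∑ i ∈ Finset.range (q (n + 1)), gap F p q n (F^[i] x) +
      ∑ i ∈ Finset.range (q n), gap F p q (n + 1) (F^[i] x) = 1 := by
  have h1 := sum_range_shift_comm (fun i => F^[i] x) (q (n + 1)) (q n)
  have hd := convergents_det h.p0 h.p1 h.q0 h.prec h.qrec n
  have e1 : ∑ i ∈ Finset.range (q (n + 1)), gap F p q n (F^[i] x) =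
      (-1) ^ n * (∑ i ∈ Finset.range (q (n + 1)), (F^[q n + i] x - F^[i] x) - q (n + 1) * p n) := by
    simp only [gap, ← Function.iterate_add_apply]
    rw [← Finset.mul_sum]
    simp [Finset.sum_sub_distrib]
    ring
  have e2 : ∑ i ∈ Finset.range (q n), gap F p q (n + 1) (F^[i] x) =
      (-1) ^ (n + 1) *
        (∑ i ∈ Finset.range (q n), (F^[q (n + 1) + i] x - F^[i] x) - q n * p (n + 1)) := by
    simp only [gap, ← Function.iterate_add_apply]
    rw [← Finset.mul_sum]
    simp [Finset.sum_sub_distrib]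
    ring
  rw [e1, e2, h1, pow_succ]
  have : ((-1 : ℝ) ^ n) * (-1) ^ n = 1 := by rw [← mul_pow]; norm_num
  rw [← hd] at this ⊢
  linear_combination this

lemma sum_gap_le (n i : ℕ) (hi : i ≤ q (n + 1)) (x : ℝ) :
    ∑ j ∈ Finset.range i, gap F p q n (F^[j] x) ≤ 1 := by
  have h1 := h.gap_total n x
  have h2 : 0 ≤ ∑ i ∈ Finset.range (q n), gap F p q (n + 1) (F^[i] x) :=
    Finset.sum_nonneg fun _ _ => (h.gap_pos _ _).le
  have h3 : ∑ j ∈ Finset.range i, gap F p q n (F^[j] x) ≤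
      ∑ j ∈ Finset.range (q (n + 1)), gap F p q n (F^[j] x) :=
    Finset.sum_le_sum_of_subset_of_nonneg (Finset.range_mono hi)
      fun _ _ _ => (h.gap_pos _ _).le
  linarith

lemma gap_le_one (n : ℕ) (x : ℝ) : gap F p q n x ≤ 1 := by
  simpa using h.sum_gap_le n 1 (h.one_le_q _) x

lemma mapsTo_iterate {n : ℕ} {x y : ℝ} (hy : y ∈ uIcc x (ret F p q n x)) (i : ℕ) :
    F^[i] y ∈ uIcc (F^[i] x) (ret F p q n (F^[i] x)) := by
  rw [← h.ret_iterate]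
  exact (h.mono.monotone.iterate i).mapsTo_uIcc hy

lemma abs_sub_le_gap {n : ℕ} {x y z : ℝ} (hy : y ∈ uIcc x (ret F p q n x))
    (hz : z ∈ uIcc x (ret F p q n x)) : |y - z| ≤ gap F p q n x := by
  rw [← h.abs_ret_sub, abs_sub_comm y z]
  have := Set.abs_sub_le_of_uIcc_subset_uIcc (Set.uIcc_subset_uIcc hy hz)
  simpa [abs_sub_comm] using this

omit h in
lemma mem_uIcc_ret {n : ℕ} {x t : ℝ} (h0 : 0 ≤ t) (h1 : t ≤ gap F p q n x) :
    x + (-1) ^ n * t ∈ uIcc x (ret F p q n x) := by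
  have e : ret F p q n x = x + (-1) ^ n * gap F p q n x := by
    rw [← ret_sub]; ring
  rw [e]
  rcases Nat.even_or_odd n with hn | hn
  · rw [hn.neg_one_pow, Set.mem_uIcc]; left; constructor <;> linarith
  · rw [hn.neg_one_pow, Set.mem_uIcc]; right; constructor <;> linarith

lemma sum_abs_sub_le {n i : ℕ} (hi : i ≤ q (n + 1)) {x y z : ℝ}
    (hy : y ∈ uIcc x (ret F p q n x)) (hz : z ∈ uIcc x (ret F p q n x)) :
    ∑ j ∈ Finset.range i, |F^[j] y - F^[j] z| ≤ 1 :=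
  (Finset.sum_le_sum fun j _ =>
    h.abs_sub_le_gap (h.mapsTo_iterate hy j) (h.mapsTo_iterate hz j)).trans (h.sum_gap_le n i hi x)

lemma intermediate_mem (n j : ℕ) (hj : j ≤ k (n + 2)) (x : ℝ) :
    F^[q n + j * q (n + 1)] x - (p n + j * p (n + 1) : ℕ) ∈ uIcc x (ret F p q n x) := by
  have h1 := displacement (F := F) (p := p) (q := q) n j x
  rw [eq_add_of_sub_eq' h1]
  have h0 : 0 ≤ ∑ i ∈ Finset.range j, gap F p q (n + 1) (F^[q n + i * q (n + 1)] x) :=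
    Finset.sum_nonneg fun _ _ => (h.gap_pos _ _).le
  apply mem_uIcc_ret
  · have h3 : ∑ i ∈ Finset.range j, gap F p q (n + 1) (F^[q n + i * q (n + 1)] x) ≤
        ∑ i ∈ Finset.range (k (n + 2)), gap F p q (n + 1) (F^[q n + i * q (n + 1)] x) :=
      Finset.sum_le_sum_of_subset_of_nonneg (Finset.range_mono hj)
        fun _ _ _ => (h.gap_pos _ _).le
    have := h.gap_eq n x
    have := h.gap_pos (n + 2) x
    linarith
  · linarith

lemma ret_add_two_mem (n : ℕ) (x : ℝ) : ret F p q (n + 2) x ∈ uIcc x (ret F p q n x) := by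
  have := h.intermediate_mem n (k (n + 2)) le_rfl x
  unfold ret at this ⊢
  rw [h.qrec, h.prec]
  simpa [add_comm] using this

end IsReturns

lemma exists_weight_contraction {θ s D A : ℝ} (h0 : 0 ≤ θ) (h1 : θ < 1) (hs : 0 < s)
    (hD : 0 ≤ D) (hA : 0 ≤ A) :
    ∃ C, 0 ≤ C ∧ ∀ a : ℕ → ℝ, a 0 ≤ A →
      (∀ n, a (n + 1) ≤ θ * a n + D * ((n : ℝ) + 1) ^ (-s)) →
      ∀ n, a n ≤ C * ((n : ℝ) + 1) ^ (-s) := by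
  have hlim : Tendsto (fun n : ℕ => (((n : ℝ) + 1 + 1) / ((n : ℝ) + 1)) ^ (-s)) atTop (𝓝 1) := by
    have h2 : Tendsto (fun n : ℕ => 1 + 1 / ((n : ℝ) + 1)) atTop (𝓝 (1 + 0)) :=
      tendsto_const_nhds.add tendsto_one_div_add_atTop_nhds_zero_nat
    have h3 : Tendsto (fun n : ℕ => (((n : ℝ) + 1 + 1) / ((n : ℝ) + 1))) atTop (𝓝 1) := by
      rw [add_zero] at h2
      refine h2.congr fun n => ?_
      have : (n : ℝ) + 1 ≠ 0 := by positivity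
      field_simp
    simpa using h3.rpow_const (p := -s) (Or.inl one_ne_zero)
  obtain ⟨M, hM⟩ := eventually_atTop.1
    (hlim.eventually (lt_mem_nhds (show (1 + θ) / 2 < 1 by linarith)))
  have epos : ∀ n : ℕ, 0 < ((n : ℝ) + 1) ^ (-s) := fun n => by positivity
  have ele : ∀ n : ℕ, ((n : ℝ) + 1) ^ (-s) ≤ 1 := fun n =>
    Real.rpow_le_one_of_one_le_of_nonpos (by linarith [n.cast_nonneg (α := ℝ)]) (by linarith)
  set C := max ((A + M * D) / ((M : ℝ) + 1) ^ (-s)) (2 * D / (1 - θ)) with hC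
  have hC1 : (A + M * D) ≤ C * ((M : ℝ) + 1) ^ (-s) := by
    rw [← div_le_iff₀ (epos M)]; exact le_max_left _ _
  have hC2 : 2 * D ≤ C * (1 - θ) := by
    rw [← div_le_iff₀ (by linarith)]; exact le_max_right _ _
  have hC0 : 0 ≤ C := le_trans (by positivity) (le_max_left _ _)
  refine ⟨C, hC0, fun a ha0 ha n => ?_⟩
  have hsmall : ∀ n : ℕ, a n ≤ A + n * D := by
    intro n
    induction n with
    | zero => simpa using ha0
    | succ n ih =>
      have h2 := ha n
      have h3 : D * ((n : ℝ) + 1) ^ (-s) ≤ D := mul_le_of_le_one_right hD (ele n)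
      have h4 : θ * a n ≤ A + n * D := by
        calc θ * a n ≤ θ * (A + n * D) := by gcongr
          _ ≤ A + n * D := mul_le_of_le_one_left (by positivity) h1.le
      push_cast
      linarith
  rcases le_total n M with hn | hn
  · calc a n ≤ A + n * D := hsmall n
      _ ≤ A + M * D := by gcongr
      _ ≤ C * ((M : ℝ) + 1) ^ (-s) := hC1
      _ ≤ C * ((n : ℝ) + 1) ^ (-s) := by
        refine mul_le_mul_of_nonneg_left ?_ hC0
        exact Real.rpow_le_rpow_of_nonpos (by positivity) (by gcongr) (by linarith)
  · induction n, hn using Nat.le_induction with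
    | base => exact (hsmall M).trans hC1
    | succ n hn ih =>
      have h2 := (hM n hn).le
      rw [Real.div_rpow (by positivity) (by positivity), le_div_iff₀ (epos n)] at h2
      have h3 := ha n
      push_cast
      have h5 := epos n
      calc a (n + 1) ≤ θ * (C * ((n : ℝ) + 1) ^ (-s)) + D * ((n : ℝ) + 1) ^ (-s) := by
            refine h3.trans ?_
            gcongr
        _ ≤ C * ((1 + θ) / 2 * ((n : ℝ) + 1) ^ (-s)) := by nlinarith
        _ ≤ _ := by gcongr

lemma le_of_backward_contraction {θ B : ℝ} (h0 : 0 ≤ θ) (h1 : θ < 1) {z E : ℕ → ℝ}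
    (hz : ∀ n, z n ≤ B) (hE : Antitone E)
    (hrec : ∀ n, z n ≤ θ * (z (n + 1) + E n)) (n : ℕ) : z n ≤ θ / (1 - θ) * E n := by
  have key : ∀ m n, z n ≤ θ ^ m * B + θ / (1 - θ) * (1 - θ ^ m) * E n := by
    intro m
    induction m with
    | zero => intro n; simpa using hz n
    | succ m ih =>
      intro n
      have h2 := ih (n + 1)
      have h3 : θ / (1 - θ) * (1 - θ ^ m) * E (n + 1) ≤ θ / (1 - θ) * (1 - θ ^ m) * E n := by
        refine mul_le_mul_of_nonneg_left (hE (Nat.le_succ n)) (mul_nonneg ?_ ?_)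
        · exact div_nonneg h0 (by linarith)
        · linarith [pow_le_one₀ h0 h1.le (n := m)]
      have h4 : (1 : ℝ) - θ ≠ 0 := by linarith
      calc z n ≤ θ * (z (n + 1) + E n) := hrec n
        _ ≤ θ * ((θ ^ m * B + θ / (1 - θ) * (1 - θ ^ m) * E n) + E n) := by gcongr; linarith
        _ = _ := by field_simp; ring
  have hpow := tendsto_pow_atTop_nhds_zero_of_lt_one h0 h1
  have hlim : Tendsto (fun m : ℕ => θ ^ m * B + θ / (1 - θ) * (1 - θ ^ m) * E n) atTop
      (𝓝 (0 * B + θ / (1 - θ) * (1 - 0) * E n)) :=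
    (hpow.mul_const B).add (((hpow.const_sub 1).const_mul _).mul_const _)
  have := ge_of_tendsto' hlim (fun m => key m n)
  simpa using this

lemma rpow_neg_sub_rpow_neg {σ x : ℝ} (hσ : 0 < σ) (hx : 1 ≤ x) :
    σ * 2 ^ (-(1 + σ)) * x ^ (-(1 + σ)) ≤ x ^ (-σ) - (x + 1) ^ (-σ) := by
  have hx0 : 0 < x := by linarith
  have e1 : x ^ (-σ) = (x + 1) ^ (-σ) * (1 - 1 / (x + 1)) ^ (-σ) := by
    rw [← Real.mul_rpow (by positivity)]
    · congr 1; field_simp; ring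
    · rw [sub_nonneg, div_le_one (by positivity)]; linarith
  have h2 : 1 + σ * (1 / (x + 1)) ≤ (1 - 1 / (x + 1)) ^ (-σ) := by
    have hpos : 0 < 1 - 1 / (x + 1) := by
      rw [sub_pos, div_lt_one (by positivity)]; linarith
    rw [Real.rpow_def_of_pos hpos]
    have h3 := Real.log_le_sub_one_of_pos hpos
    have h4 := Real.add_one_le_exp (Real.log (1 - 1 / (x + 1)) * -σ)
    nlinarith
  have h3 : (x + 1) ^ (-(1 + σ)) = (x + 1) ^ (-σ) * (1 / (x + 1)) := by
    rw [neg_add_rev, Real.rpow_add (by positivity), Real.rpow_neg_one, one_div]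
  have h4 : (2 : ℝ) ^ (-(1 + σ)) * x ^ (-(1 + σ)) ≤ (x + 1) ^ (-(1 + σ)) := by
    rw [← Real.mul_rpow (by norm_num) hx0.le]
    exact Real.rpow_le_rpow_of_nonpos (by positivity) (by linarith) (by linarith)
  have h5 : 0 < (x + 1) ^ (-σ) := by positivity
  calc σ * 2 ^ (-(1 + σ)) * x ^ (-(1 + σ)) = σ * (2 ^ (-(1 + σ)) * x ^ (-(1 + σ))) := by ring
    _ ≤ σ * ((x + 1) ^ (-σ) * (1 / (x + 1))) := by rw [← h3]; gcongr
    _ ≤ (x + 1) ^ (-σ) * (1 - 1 / (x + 1)) ^ (-σ) - (x + 1) ^ (-σ) := by nlinarith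
    _ = _ := by rw [← e1]

lemma exists_sum_weight_le {σ : ℝ} (hσ : 0 < σ) :
    ∃ C, 0 < C ∧ ∀ n N : ℕ, n ≤ N → ∑ m ∈ Finset.Ico n N, ((m : ℝ) + 1) ^ (-(1 + σ)) ≤
      C * ((n : ℝ) + 1) ^ (-σ) := by
  have hc : 0 < σ * 2 ^ (-(1 + σ)) := by positivity
  refine ⟨1 / (σ * 2 ^ (-(1 + σ))), by positivity, fun n N hnN => ?_⟩
  rw [one_div, inv_mul_eq_div, le_div_iff₀' hc, Finset.mul_sum]
  have : ∑ m ∈ Finset.Ico n N, σ * 2 ^ (-(1 + σ)) * ((m : ℝ) + 1) ^ (-(1 + σ)) ≤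
      ((n : ℝ) + 1) ^ (-σ) - ((N : ℝ) + 1) ^ (-σ) := by
    induction N, hnN using Nat.le_induction with
    | base => simp
    | succ N hN ih =>
      rw [Finset.sum_Ico_succ_top hN]
      have := rpow_neg_sub_rpow_neg hσ (x := (N : ℝ) + 1) (by linarith [N.cast_nonneg (α := ℝ)])
      push_cast
      linarith
  have h2 : (0 : ℝ) < ((N : ℝ) + 1) ^ (-σ) := by positivity
  linarith

lemma abs_log_affine_exp_le {t w : ℝ} (h0 : 0 ≤ t) (h1 : t ≤ 1) :
    |Real.log (1 - t + t * Real.exp w)| ≤ (1 - (1 - t) / (1 + |w|)) * |w| := by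
  have hE := Real.exp_pos w
  have hpos : 0 < 1 - t + t * Real.exp w := by
    rcases h0.eq_or_lt with rfl | h0
    · simp
    · nlinarith [mul_pos h0 hE]
  have hconv : t * w ≤ Real.log (1 - t + t * Real.exp w) := by
    rw [Real.le_log_iff_exp_le hpos]
    have := convexOn_exp.2 (mem_univ 0) (mem_univ w) (sub_nonneg.2 h1) h0 (by ring)
    simpa using this
  rcases le_total 0 w with hw | hw
  · rw [abs_of_nonneg hw, abs_of_nonneg ((mul_nonneg h0 hw).trans hconv)]
    have e : 1 - t + t * Real.exp w = Real.exp w * (1 - (1 - t) * (1 - Real.exp (-w))) := by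
      rw [Real.exp_neg]; field_simp; ring
    have h3 : Real.exp (-w) ≤ 1 / (1 + w) := by
      rw [Real.exp_neg, ← one_div]
      apply one_div_le_one_div_of_le (by linarith)
      linarith [Real.add_one_le_exp w]
    have hpos2 : 0 < 1 - (1 - t) * (1 - Real.exp (-w)) := by
      rw [e] at hpos; exact (mul_pos_iff_of_pos_left hE).1 hpos
    rw [e, Real.log_mul hE.ne' hpos2.ne', Real.log_exp]
    have h4 := Real.log_le_sub_one_of_pos hpos2
    have h5 : (1 - t) * (1 - 1 / (1 + w)) ≤ (1 - t) * (1 - Real.exp (-w)) := by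
      apply mul_le_mul_of_nonneg_left <;> linarith
    have h6 : (1 - t) / (1 + w) * w = (1 - t) * (1 - 1 / (1 + w)) := by
      field_simp; ring
    linarith
  · have hle : Real.log (1 - t + t * Real.exp w) ≤ 0 := by
      apply Real.log_nonpos hpos.le
      have : Real.exp w ≤ 1 := Real.exp_le_one_iff.2 hw
      nlinarith
    rw [abs_of_nonpos hw, abs_of_nonpos hle]
    have h3 : (1 - t) / (1 + -w) ≤ 1 - t := div_le_self (by linarith) (by linarith)
    nlinarith

lemma hasDerivAt_iterate {F u : ℝ → ℝ} (hd : ∀ x, HasDerivAt F (Real.exp (u x)) x) (i : ℕ)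
    (x : ℝ) : HasDerivAt F^[i] (Real.exp (birkhoffSum F u i x)) x := by
  induction i with
  | zero => simpa using hasDerivAt_id x
  | succ i ih =>
    rw [birkhoffSum_succ, Real.exp_add, mul_comm, Function.iterate_succ']
    exact (hd _).comp x ih

lemma exists_iterate_sub_eq {F u : ℝ → ℝ} (hd : ∀ x, HasDerivAt F (Real.exp (u x)) x) (i : ℕ)
    (y z : ℝ) : ∃ ζ ∈ uIcc y z,
      F^[i] z - F^[i] y = Real.exp (birkhoffSum F u i ζ) * (z - y) := by
  have key : ∀ y z, y < z → ∃ ζ ∈ uIcc y z,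
      F^[i] z - F^[i] y = Real.exp (birkhoffSum F u i ζ) * (z - y) := by
    intro y z hyz
    obtain ⟨ζ, hζ, he⟩ := exists_hasDerivAt_eq_slope F^[i] _ hyz
      (fun x _ => (hasDerivAt_iterate hd i x).continuousAt.continuousWithinAt)
      (fun x _ => hasDerivAt_iterate hd i x)
    refine ⟨ζ, Set.Icc_subset_uIcc (Set.Ioo_subset_Icc_self hζ), ?_⟩
    rw [he]
    have : z - y ≠ 0 := by linarith
    field_simp
  rcases lt_trichotomy y z with hyz | rfl | hyz
  · exact key y z hyz
  · exact ⟨y, Set.left_mem_uIcc, by simp⟩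
  · obtain ⟨ζ, hζ, he⟩ := key z y hyz
    exact ⟨ζ, Set.uIcc_comm z y ▸ hζ, by linarith⟩

lemma birkhoffSum_iterate_comm (F u : ℝ → ℝ) (m l : ℕ) (x : ℝ) :
    birkhoffSum F u m (F^[l] x) - birkhoffSum F u m x =
      birkhoffSum F u l (F^[m] x) - birkhoffSum F u l x := by
  have h1 := birkhoffSum_add F u l m x
  have h2 := birkhoffSum_add F u m l x
  rw [add_comm] at h2
  linarith

lemma birkhoffSum_sub_nat {F u : ℝ → ℝ} (hdeg : ∀ x, F (x + 1) = F x + 1)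
    (hu : ∀ x, u (x + 1) = u x) (i m : ℕ) (x : ℝ) :
    birkhoffSum F u i (x - m) = birkhoffSum F u i x := by
  simp only [birkhoffSum, iterate_sub_nat hdeg, periodic_sub_nat hu]

lemma birkhoffSum_mul (F u : ℝ → ℝ) (q r j : ℕ) (x : ℝ) :
    birkhoffSum F u (r + j * q) x =
      birkhoffSum F u r x + ∑ i ∈ Finset.range j, birkhoffSum F u q (F^[r + i * q] x) := by
  induction j with
  | zero => simp
  | succ j ih =>
    rw [show r + (j + 1) * q = r + j * q + q by ring, birkhoffSum_add, ih, Finset.sum_range_succ,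
      add_assoc]

/-- A circle map with closest returns whose log-derivative `u` is periodic, bounded by `V` and
`V`-Lipschitz. -/
structure IsSmoothReturns (F u : ℝ → ℝ) (k p q : ℕ → ℕ) (V : ℝ) : Prop
    extends IsReturns F k p q where
  hasDerivAt : ∀ x, HasDerivAt F (Real.exp (u x)) x
  periodic : ∀ x, u (x + 1) = u x
  bound : ∀ x, |u x| ≤ V
  lip : ∀ x y, |u x - u y| ≤ V * |x - y|

namespace IsSmoothReturns

variable {F u : ℝ → ℝ} {k p q : ℕ → ℕ} {V : ℝ} (h : IsSmoothReturns F u k p q V)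

include h

lemma V_nonneg : 0 ≤ V := (abs_nonneg _).trans (h.bound 0)

lemma birkhoffSum_ret (i n : ℕ) (x : ℝ) :
    birkhoffSum F u i (ret F p q n x) = birkhoffSum F u i (F^[q n] x) :=
  birkhoffSum_sub_nat h.deg h.periodic _ _ _

lemma denjoy {n i : ℕ} (hi : i ≤ q (n + 1)) {x y z : ℝ}
    (hy : y ∈ uIcc x (ret F p q n x)) (hz : z ∈ uIcc x (ret F p q n x)) :
    |birkhoffSum F u i y - birkhoffSum F u i z| ≤ V := by
  unfold birkhoffSum
  rw [← Finset.sum_sub_distrib]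
  calc _ ≤ ∑ j ∈ Finset.range i, |u (F^[j] y) - u (F^[j] z)| := Finset.abs_sum_le_sum_abs _ _
    _ ≤ ∑ j ∈ Finset.range i, V * |F^[j] y - F^[j] z| := Finset.sum_le_sum fun _ _ => h.lip _ _
    _ = V * ∑ j ∈ Finset.range i, |F^[j] y - F^[j] z| := by rw [Finset.mul_sum]
    _ ≤ V * 1 := mul_le_mul_of_nonneg_left (h.sum_abs_sub_le hi hy hz) h.V_nonneg
    _ = V := mul_one V

lemma exists_gap_iterate (n i : ℕ) (x : ℝ) : ∃ ζ ∈ uIcc x (ret F p q n x),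
    gap F p q n (F^[i] x) = Real.exp (birkhoffSum F u i ζ) * gap F p q n x := by
  obtain ⟨ζ, hζ, he⟩ := exists_iterate_sub_eq h.hasDerivAt i x (ret F p q n x)
  refine ⟨ζ, hζ, ?_⟩
  rw [h.ret_iterate] at he
  rw [← h.abs_ret_sub, he, abs_mul, h.abs_ret_sub, abs_of_pos (Real.exp_pos _)]

lemma abs_birkhoffSum_q_le (n : ℕ) (x : ℝ) : |birkhoffSum F u (q n) x| ≤ 2 * V := by
  have hV := h.V_nonneg
  match n with
  | 0 =>
    rw [h.q0, birkhoffSum_one]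
    linarith [h.bound x]
  | n + 1 =>
    set A := birkhoffSum F u (q (n + 1)) x with hA
    have near : ∀ i ≤ q (n + 1), |birkhoffSum F u (q (n + 1)) (F^[i] x) - A| ≤ V := by
      intro i hi
      rw [hA, birkhoffSum_iterate_comm, ← h.birkhoffSum_ret]
      exact h.denjoy (hi.trans (h.q_le_succ _)) Set.right_mem_uIcc Set.left_mem_uIcc
    have near2 : ∀ m, m = n ∨ m = n + 1 → ∀ i ≤ q (n + 1), ∃ B, |B - A| ≤ 2 * V ∧
        gap F p q m (F^[i] (F^[q (n + 1)] x)) = Real.exp B * gap F p q m (F^[i] x) := by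
      intro m hm i hi
      obtain ⟨ζ, hζ, he⟩ := h.exists_gap_iterate m (q (n + 1)) (F^[i] x)
      refine ⟨birkhoffSum F u (q (n + 1)) ζ, ?_, ?_⟩
      · have h1 := near i hi
        have h2 : |birkhoffSum F u (q (n + 1)) ζ - birkhoffSum F u (q (n + 1)) (F^[i] x)| ≤ V := by
          rcases hm with rfl | rfl
          · exact h.denjoy le_rfl hζ Set.left_mem_uIcc
          · exact h.denjoy (h.q_le_succ _) hζ Set.left_mem_uIcc
        rw [abs_le] at h1 h2 ⊢
        constructor <;> linarith
      · rw [← he, ← Function.iterate_add_apply, ← Function.iterate_add_apply, add_comm]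
    have t1 := h.gap_total n x
    have t2 := h.gap_total n (F^[q (n + 1)] x)
    have hpos := h.gap_pos
    have up : 1 ≤ Real.exp (A + 2 * V) := by
      calc (1 : ℝ) = _ := t2.symm
        _ ≤ ∑ i ∈ Finset.range (q (n + 1)), Real.exp (A + 2 * V) * gap F p q n (F^[i] x) +
            ∑ i ∈ Finset.range (q n), Real.exp (A + 2 * V) * gap F p q (n + 1) (F^[i] x) := by
          refine add_le_add (Finset.sum_le_sum fun i hi => ?_) (Finset.sum_le_sum fun i hi => ?_)
          · obtain ⟨B, hB, he⟩ := near2 n (Or.inl rfl) i (Finset.mem_range.1 hi).le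
            rw [he]
            refine mul_le_mul_of_nonneg_right (Real.exp_le_exp.2 ?_) (hpos _ _).le
            linarith [(abs_le.1 hB).2]
          · obtain ⟨B, hB, he⟩ := near2 (n + 1) (Or.inr rfl) i
              ((Finset.mem_range.1 hi).le.trans (h.q_le_succ n))
            rw [he]
            refine mul_le_mul_of_nonneg_right (Real.exp_le_exp.2 ?_) (hpos _ _).le
            linarith [(abs_le.1 hB).2]
        _ = Real.exp (A + 2 * V) := by
          rw [← Finset.mul_sum, ← Finset.mul_sum, ← mul_add, t1, mul_one]
    have down : Real.exp (A - 2 * V) ≤ 1 := by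
      calc Real.exp (A - 2 * V)
        _ = ∑ i ∈ Finset.range (q (n + 1)), Real.exp (A - 2 * V) * gap F p q n (F^[i] x) +
            ∑ i ∈ Finset.range (q n), Real.exp (A - 2 * V) * gap F p q (n + 1) (F^[i] x) := by
          rw [← Finset.mul_sum, ← Finset.mul_sum, ← mul_add, t1, mul_one]
        _ ≤ _ := by
          refine add_le_add (Finset.sum_le_sum fun i hi => ?_) (Finset.sum_le_sum fun i hi => ?_)
          · obtain ⟨B, hB, he⟩ := near2 n (Or.inl rfl) i (Finset.mem_range.1 hi).le
            rw [he]
            refine mul_le_mul_of_nonneg_right (Real.exp_le_exp.2 ?_) (hpos _ _).le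
            linarith [(abs_le.1 hB).1]
          · obtain ⟨B, hB, he⟩ := near2 (n + 1) (Or.inr rfl) i
              ((Finset.mem_range.1 hi).le.trans (h.q_le_succ n))
            rw [he]
            refine mul_le_mul_of_nonneg_right (Real.exp_le_exp.2 ?_) (hpos _ _).le
            linarith [(abs_le.1 hB).1]
        _ = 1 := t2
    rw [Real.one_le_exp_iff] at up
    rw [Real.exp_le_one_iff] at down
    rw [abs_le]
    constructor <;> linarith

lemma gap_add_two_le (n : ℕ) (x : ℝ) :
    gap F p q (n + 2) x ≤ 1 / (1 + Real.exp (-(4 * V))) * gap F p q n x := by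
  have lower : ∀ m i, gap F p q m x * Real.exp (-(2 * V)) ≤ gap F p q m (F^[q i] x) := by
    intro m i
    obtain ⟨ζ, -, he⟩ := h.exists_gap_iterate m (q i) x
    rw [he, mul_comm]
    refine mul_le_mul_of_nonneg_right (Real.exp_le_exp.2 ?_) (h.gap_pos _ _).le
    exact (abs_le.1 (h.abs_birkhoffSum_q_le i ζ)).1
  have first : ∀ n, gap F p q (n + 2) x + gap F p q (n + 1) (F^[q n] x) ≤ gap F p q n x := by
    intro n
    rw [h.gap_eq n]
    gcongr
    have := Finset.single_le_sum
      (f := fun i => gap F p q (n + 1) (F^[q n + i * q (n + 1)] x))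
      (fun i _ => (h.gap_pos _ _).le) (Finset.mem_range.2 (h.one_le_k (n + 1)))
    simpa using this
  have h1 := first n
  have h2 := first (n + 1)
  have h3 := lower (n + 1) n
  have h4 := lower (n + 2) (n + 1)
  have h5 := h.gap_pos (n + 1 + 2) x
  have e : Real.exp (-(4 * V)) = Real.exp (-(2 * V)) * Real.exp (-(2 * V)) := by
    rw [← Real.exp_add]; ring_nf
  rw [one_div, inv_mul_eq_div, le_div_iff₀ (by positivity), e]
  have h6 : gap F p q (n + 2) x * Real.exp (-(2 * V)) ≤ gap F p q (n + 1) x := by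
    change _ ≤ _ at h2
    have : n + 1 + 1 = n + 2 := rfl
    rw [this] at h2
    linarith
  nlinarith [mul_le_mul_of_nonneg_right h6 (Real.exp_pos (-(2 * V))).le]

lemma exists_gap_le : ∃ μ C : ℝ, 0 < μ ∧ μ < 1 ∧ 0 < C ∧ ∀ n x, gap F p q n x ≤ C * μ ^ n := by
  set t := 1 / (1 + Real.exp (-(4 * V))) with ht
  have t0 : 0 < t := by positivity
  have t1 : t < 1 := by
    rw [ht, div_lt_one (by positivity)]; linarith [Real.exp_pos (-(4 * V))]
  have s0 : 0 < √t := Real.sqrt_pos.2 t0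
  have s1 : √t < 1 := by rw [Real.sqrt_lt' one_pos]; simpa using t1
  refine ⟨√t, 1 / √t, s0, s1, by positivity, fun n x => ?_⟩
  induction n using Nat.strong_induction_on with
  | _ n ih =>
    match n with
    | 0 =>
      refine (h.gap_le_one 0 x).trans ?_
      rw [pow_zero, mul_one, le_div_iff₀ s0]
      linarith
    | 1 =>
      refine (h.gap_le_one 1 x).trans ?_
      rw [pow_one, div_mul_cancel₀ _ s0.ne']
    | n + 2 =>
      calc gap F p q (n + 2) x ≤ t * gap F p q n x := h.gap_add_two_le n x
        _ ≤ t * (1 / √t * √t ^ n) := by gcongr; exact ih n (by omega)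
        _ = 1 / √t * √t ^ (n + 2) := by
          rw [pow_add, Real.sq_sqrt t0.le]; ring

end IsSmoothReturns

lemma abs_sub_le_of_trapezoid {A X B r₁ r₂ r τ E : ℝ} (h0 : 0 ≤ τ) (h1 : τ ≤ 1)
    (hr : Real.exp r = τ * Real.exp r₁ + (1 - τ) * Real.exp r₂)
    (h₁ : |r₁ - (A + X) / 2| ≤ E) (h₂ : |r₂ - (X + B) / 2| ≤ E) (h₃ : |r - (A + B) / 2| ≤ E) :
    |X - A| ≤ (1 - (1 - τ) / (1 + |B - A| / 2)) * |B - A| + 4 * E := by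
  have hS := abs_log_affine_exp_le (w := -((B - A) / 2)) h0 h1
  set S := Real.log (1 - τ + τ * Real.exp (-((B - A) / 2))) with hSdef
  have hpos : 0 < 1 - τ + τ * Real.exp (-((B - A) / 2)) := by
    rcases h0.eq_or_lt with rfl | h0
    · simp
    · nlinarith [mul_pos h0 (Real.exp_pos (-((B - A) / 2)))]
  have eS : ∀ t, τ * Real.exp ((A + X) / 2 + t) + (1 - τ) * Real.exp ((X + B) / 2 + t) =
      Real.exp ((X + B) / 2 + t + S) := by
    intro t
    rw [Real.exp_add _ S, hSdef, Real.exp_log hpos, show (A + X) / 2 + t =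
      ((X + B) / 2 + t) + (-((B - A) / 2)) by ring, Real.exp_add _ (-((B - A) / 2))]
    ring
  rw [abs_le] at h₁ h₂ h₃
  have up : r ≤ (X + B) / 2 + E + S := by
    rw [← Real.exp_le_exp, ← eS, hr]
    refine add_le_add (mul_le_mul_of_nonneg_left (Real.exp_le_exp.2 ?_) h0)
      (mul_le_mul_of_nonneg_left (Real.exp_le_exp.2 ?_) (by linarith)) <;> linarith
  have down : (X + B) / 2 + -E + S ≤ r := by
    rw [← Real.exp_le_exp, ← eS, hr]
    refine add_le_add (mul_le_mul_of_nonneg_left (Real.exp_le_exp.2 ?_) h0)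
      (mul_le_mul_of_nonneg_left (Real.exp_le_exp.2 ?_) (by linarith)) <;> linarith
  rw [abs_neg, abs_div, abs_of_pos (two_pos : (0 : ℝ) < 2)] at hS
  have hS2 := abs_le.1 hS
  have : |X - A| ≤ 2 * ((1 - (1 - τ) / (1 + |B - A| / 2)) * (|B - A| / 2)) + 4 * E := by
    rw [abs_le]
    constructor <;> linarith
  linarith

/-- Closest returns of a circle map with rotation number `ρ` and partial quotients at most `K`,
whose difference quotients over `n`-th return intervals obey a trapezoid rule with relative error
of order `(n + 1) ^ (-(1 + σ))`. -/
structure IsRegularReturns (F u : ℝ → ℝ) (k p q : ℕ → ℕ) (V ρ σ D : ℝ) (K : ℕ) : Prop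
    extends IsSmoothReturns F u k p q V where
  sigma_pos : 0 < σ
  D_nonneg : 0 ≤ D
  k_le : ∀ n, k (n + 1) ≤ K
  rot_pos : ∀ n, 0 < (-1) ^ n * (q n * ρ - p n)
  trapezoid : ∀ n x y z, y ∈ Set.uIcc x (ret F p q n x) → z ∈ Set.uIcc x (ret F p q n x) →
    y ≠ z → |Real.log ((F y - F z) / (y - z)) - (u y + u z) / 2| ≤
      D * ((n : ℝ) + 1) ^ (-(1 + σ)) * |y - z|

namespace IsRegularReturns

variable {F u : ℝ → ℝ} {k p q : ℕ → ℕ} {V ρ σ D : ℝ} {K : ℕ}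
  (h : IsRegularReturns F u k p q V ρ σ D K)

include h

lemma ratio_pos (i : ℕ) {y z : ℝ} (hyz : y ≠ z) : 0 < (F^[i] y - F^[i] z) / (y - z) := by
  have hm := h.mono.iterate i
  rcases lt_or_gt_of_ne hyz with h1 | h1
  · exact div_pos_of_neg_of_neg (by linarith [hm h1]) (by linarith)
  · exact div_pos (by linarith [hm h1]) (by linarith)

lemma trapezoid_iterate {n i : ℕ} (hi : i ≤ q (n + 1)) {x y z : ℝ}
    (hy : y ∈ uIcc x (ret F p q n x)) (hz : z ∈ uIcc x (ret F p q n x)) (hyz : y ≠ z) :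
    |Real.log ((F^[i] y - F^[i] z) / (y - z)) - (birkhoffSum F u i y + birkhoffSum F u i z) / 2| ≤
      D * ((n : ℝ) + 1) ^ (-(1 + σ)) := by
  have key : ∀ i, |Real.log ((F^[i] y - F^[i] z) / (y - z)) -
      (birkhoffSum F u i y + birkhoffSum F u i z) / 2| ≤
      D * ((n : ℝ) + 1) ^ (-(1 + σ)) * ∑ j ∈ Finset.range i, |F^[j] y - F^[j] z| := by
    intro i
    induction i with
    | zero => simp [div_self (sub_ne_zero.2 hyz)]
    | succ i ih =>
      have hne : F^[i] y ≠ F^[i] z := (h.mono.iterate i).injective.ne hyz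
      have h1 := h.trapezoid n _ _ _ (h.mapsTo_iterate hy i) (h.mapsTo_iterate hz i) hne
      have e : (F^[i + 1] y - F^[i + 1] z) / (y - z) =
          (F^[i] y - F^[i] z) / (y - z) *
            ((F (F^[i] y) - F (F^[i] z)) / (F^[i] y - F^[i] z)) := by
        rw [Function.iterate_succ_apply', Function.iterate_succ_apply']
        have := sub_ne_zero.2 hne
        field_simp
      have hpos := h.ratio_pos 1 hne
      rw [e, Real.log_mul (h.ratio_pos i hyz).ne' (by simpa using hpos.ne'), birkhoffSum_succ,
        birkhoffSum_succ, Finset.sum_range_succ, mul_add]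
      rw [abs_le] at ih h1 ⊢
      constructor <;> linarith
  refine (key i).trans (mul_le_of_le_one_right ?_ (h.sum_abs_sub_le hi hy hz))
  exact mul_nonneg h.D_nonneg (by positivity)

lemma abs_birkhoffSum_sub_le {n i : ℕ} (hi : i ≤ q (n + 1)) {x y t : ℝ}
    (hy : y ∈ uIcc x (ret F p q n x)) (ht : t ≤ 1) (hyt : |y - x| ≤ t * gap F p q n x) :
    |birkhoffSum F u i y - birkhoffSum F u i x| ≤
      (1 - (1 - t) / (1 + V)) *
        |birkhoffSum F u i (ret F p q n x) - birkhoffSum F u i x| +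
        4 * (D * ((n : ℝ) + 1) ^ (-(1 + σ))) := by
  have hg := h.gap_pos n x
  have hV := h.V_nonneg
  have hE : 0 ≤ D * ((n : ℝ) + 1) ^ (-(1 + σ)) := mul_nonneg h.D_nonneg (by positivity)
  have ht0 : 0 ≤ t := by
    by_contra! hneg
    have := mul_neg_of_neg_of_pos hneg hg
    linarith [abs_nonneg (y - x)]
  have hθ : 0 ≤ 1 - (1 - t) / (1 + V) := by
    rw [sub_nonneg, div_le_one (by linarith)]; linarith
  set b := ret F p q n x with hb
  have hbx : b ≠ x := by
    intro e
    have := h.abs_ret_sub n x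
    rw [← hb, e, sub_self, abs_zero] at this
    linarith
  have hxm : x ∈ uIcc x b := Set.left_mem_uIcc
  have hbm : b ∈ uIcc x b := Set.right_mem_uIcc
  rcases eq_or_ne y x with rfl | hyx
  · rw [sub_self, abs_zero]; positivity
  rcases eq_or_ne y b with hyb | hyb
  · rw [hyb, h.abs_ret_sub] at hyt
    have : t = 1 := le_antisymm ht (by
      by_contra! hlt
      nlinarith)
    rw [hyb, this]
    simpa using hE
  set τ := (y - x) / (b - x) with hτ
  have hbx' := sub_ne_zero.2 hbx
  have hτ0 : 0 ≤ τ := by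
    rcases Set.mem_uIcc.1 hy with hc | hc
    · exact div_nonneg (by linarith) (by linarith)
    · exact div_nonneg_of_nonpos (by linarith) (by linarith)
  have hτt : τ ≤ t := by
    rw [← abs_of_nonneg hτ0, hτ, abs_div, h.abs_ret_sub, div_le_iff₀ hg]
    exact hyt
  have h₁ := h.trapezoid_iterate hi hxm hy hyx.symm
  have h₂ := h.trapezoid_iterate hi hy hbm hyb
  have h₃ := h.trapezoid_iterate hi hxm hbm hbx.symm
  have hr : Real.exp (Real.log ((F^[i] x - F^[i] b) / (x - b))) =
      τ * Real.exp (Real.log ((F^[i] x - F^[i] y) / (x - y))) +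
        (1 - τ) * Real.exp (Real.log ((F^[i] y - F^[i] b) / (y - b))) := by
    rw [Real.exp_log (h.ratio_pos i hbx.symm), Real.exp_log (h.ratio_pos i hyx.symm),
      Real.exp_log (h.ratio_pos i hyb)]
    have e1 : x - b ≠ 0 := sub_ne_zero.2 hbx.symm
    have e2 : x - y ≠ 0 := sub_ne_zero.2 hyx.symm
    have e3 : y - b ≠ 0 := sub_ne_zero.2 hyb
    have e4 : τ = (x - y) / (x - b) := by
      rw [hτ, ← neg_sub x y, ← neg_sub x b, neg_div_neg_eq]
    have e5 : 1 - τ = (y - b) / (x - b) := by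
      rw [e4]; field_simp; ring
    rw [e5, e4]
    field_simp
    ring
  have hmain := abs_sub_le_of_trapezoid hτ0 (hτt.trans ht) hr h₁ h₂ h₃
  have hs := h.toIsSmoothReturns.denjoy hi hbm hxm
  refine hmain.trans ?_
  gcongr
  · linarith
  · linarith [abs_nonneg (birkhoffSum F u i b - birkhoffSum F u i x)]

lemma birkhoffSum_ret_sub_comm (n : ℕ) (m : ℕ) (x : ℝ) :
    birkhoffSum F u m (ret F p q n x) - birkhoffSum F u m x =
      birkhoffSum F u (q n) (F^[m] x) - birkhoffSum F u (q n) x := by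
  rw [h.birkhoffSum_ret, birkhoffSum_iterate_comm]

lemma exists_ret_osc_le : ∃ C, 0 ≤ C ∧ ∀ n x,
    |birkhoffSum F u (q (n + 1)) (ret F p q n x) - birkhoffSum F u (q (n + 1)) x| ≤
      C * ((n : ℝ) + 1) ^ (-(1 + σ)) := by
  have hV := h.V_nonneg
  set t := 1 / (1 + Real.exp (-(4 * V))) with ht
  have t0 : 0 < t := by positivity
  have t1 : t < 1 := by
    rw [ht, div_lt_one (by positivity)]; linarith [Real.exp_pos (-(4 * V))]
  obtain ⟨C, hC, hmain⟩ := exists_weight_contraction (θ := 1 - (1 - t) / (1 + V)) (s := 1 + σ)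
    (D := 4 * D) (A := V)
    (by rw [sub_nonneg, div_le_one (by linarith)]; linarith)
    (by rw [sub_lt_self_iff]; exact div_pos (by linarith) (by linarith))
    (by linarith [h.sigma_pos]) (by linarith [h.D_nonneg]) hV
  refine ⟨C, hC, fun n x => hmain (fun n => |birkhoffSum F u (q (n + 1)) (ret F p q n x) -
    birkhoffSum F u (q (n + 1)) x|) ?_ ?_ n⟩
  · exact h.toIsSmoothReturns.denjoy le_rfl Set.right_mem_uIcc Set.left_mem_uIcc
  · intro n
    have h1 : birkhoffSum F u (q (n + 1 + 1)) (ret F p q (n + 1) x) -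
        birkhoffSum F u (q (n + 1 + 1)) x =
        birkhoffSum F u (q (n + 1)) (ret F p q (n + 2) x) - birkhoffSum F u (q (n + 1)) x := by
      rw [h.birkhoffSum_ret_sub_comm, h.birkhoffSum_ret, birkhoffSum_iterate_comm,
        birkhoffSum_iterate_comm]
    simp only [h1]
    have h2 := h.abs_birkhoffSum_sub_le (n := n) le_rfl (h.ret_add_two_mem n x) t1.le
      (by rw [h.abs_ret_sub]; exact h.toIsSmoothReturns.gap_add_two_le n x)
    linarith

lemma exists_osc_le : ∃ C, 0 ≤ C ∧ ∀ n x, ∀ y ∈ uIcc x (ret F p q n x),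
    |birkhoffSum F u (q (n + 1)) y - birkhoffSum F u (q (n + 1)) x| ≤
      C * ((n : ℝ) + 1) ^ (-(1 + σ)) := by
  obtain ⟨C, hC, hmain⟩ := h.exists_ret_osc_le
  refine ⟨C + 4 * D, by linarith [h.D_nonneg], fun n x y hy => ?_⟩
  have h1 := h.abs_birkhoffSum_sub_le (n := n) le_rfl hy le_rfl
    (by rw [one_mul]; exact h.abs_sub_le_gap hy Set.left_mem_uIcc)
  have h2 := hmain n x
  simp only [sub_self, zero_div, sub_zero, one_mul] at h1
  linarith

lemma exists_recurrence_le : ∃ C, 0 ≤ C ∧ ∀ n x,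
    |birkhoffSum F u (q (n + 2)) x - birkhoffSum F u (q n) x -
      k (n + 2) * birkhoffSum F u (q (n + 1)) x| ≤ C * ((n : ℝ) + 1) ^ (-(1 + σ)) := by
  obtain ⟨C, hC, hmain⟩ := h.exists_osc_le
  refine ⟨K * C, by positivity, fun n x => ?_⟩
  have e : birkhoffSum F u (q (n + 2)) x - birkhoffSum F u (q n) x -
      k (n + 2) * birkhoffSum F u (q (n + 1)) x =
      ∑ i ∈ Finset.range (k (n + 2)),
        (birkhoffSum F u (q (n + 1)) (F^[q n + i * q (n + 1)] x -
          (p n + i * p (n + 1) : ℕ)) - birkhoffSum F u (q (n + 1)) x) := by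
    rw [h.qrec, add_comm (_ * _), birkhoffSum_mul, Finset.sum_sub_distrib]
    simp only [birkhoffSum_sub_nat h.deg h.periodic]
    simp
  rw [e]
  calc _ ≤ ∑ i ∈ Finset.range (k (n + 2)), C * ((n : ℝ) + 1) ^ (-(1 + σ)) :=
        (Finset.abs_sum_le_sum_abs _ _).trans (Finset.sum_le_sum fun i hi =>
          hmain n x _ (h.intermediate_mem n i (Finset.mem_range.1 hi).le x))
    _ = k (n + 2) * (C * ((n : ℝ) + 1) ^ (-(1 + σ))) := by simp
    _ ≤ K * (C * ((n : ℝ) + 1) ^ (-(1 + σ))) := by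
        gcongr
        exact_mod_cast h.k_le (n + 1)
    _ = _ := by ring

lemma exists_birkhoffSum_q_le : ∃ C, 0 < C ∧ ∀ n x,
    |birkhoffSum F u (q n) x| ≤ C * ((n : ℝ) + 1) ^ (-(1 + σ)) := by
  have hV := h.V_nonneg
  obtain ⟨C, hC, hrec⟩ := h.exists_recurrence_le
  set d : ℕ → ℝ := fun n => (-1) ^ n * (q n * ρ - p n) with hd
  have dpos : ∀ n, 0 < d n := h.rot_pos
  have drec : ∀ n, d n = k (n + 2) * d (n + 1) + d (n + 2) := by
    intro n
    simp only [hd, h.qrec, h.prec, pow_succ]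
    push_cast
    ring
  have k1 : ∀ n, (1 : ℝ) ≤ k (n + 1) := fun n => by exact_mod_cast h.one_le_k n
  have kK : ∀ n, (k (n + 1) : ℝ) ≤ K := fun n => by exact_mod_cast h.k_le n
  have dmono : ∀ n, d (n + 1) ≤ d n := fun n => by
    have := drec n
    have := dpos (n + 2)
    nlinarith [dpos (n + 1), k1 (n + 1)]
  have dratio : ∀ n, d (n + 1) / d n ≤ (K + 1 : ℝ) / (K + 2) := by
    intro n
    rw [div_le_div_iff₀ (dpos n) (by positivity)]
    have a1 := drec n
    have a2 := drec (n + 1)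
    have a3 := dmono (n + 2)
    have a4 : d (n + 1) ≤ (K + 1) * d (n + 2) := by
      have := mul_le_mul_of_nonneg_right (kK (n + 2)) (dpos (n + 2)).le
      linarith
    have a5 : d (n + 1) + d (n + 2) ≤ d n := by
      have := mul_le_mul_of_nonneg_right (k1 (n + 1)) (dpos (n + 1)).le
      linarith
    nlinarith
  set θ : ℝ := (K + 1 : ℝ) / (K + 2) with hθ
  have θ0 : 0 ≤ θ := by positivity
  have θ1 : θ < 1 := by rw [hθ, div_lt_one (by positivity)]; linarith
  have hE : Antitone fun n : ℕ => C * ((n : ℝ) + 1) ^ (-(1 + σ)) := by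
    intro a b hab
    refine mul_le_mul_of_nonneg_left ?_ hC
    exact Real.rpow_le_rpow_of_nonpos (by positivity) (by gcongr) (by linarith [h.sigma_pos])
  have hw : ∀ n x, |birkhoffSum F u (q (n + 1)) x + d (n + 1) / d n * birkhoffSum F u (q n) x| ≤
      θ / (1 - θ) * (C * ((n : ℝ) + 1) ^ (-(1 + σ))) := by
    intro n x
    refine le_of_backward_contraction (B := 4 * V) θ0 θ1
      (z := fun n => |birkhoffSum F u (q (n + 1)) x +
        d (n + 1) / d n * birkhoffSum F u (q n) x|) ?_ hE ?_ n
    · intro n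
      have a1 := h.abs_birkhoffSum_q_le (n + 1) x
      have a2 := h.abs_birkhoffSum_q_le n x
      have a3 : |d (n + 1) / d n| ≤ 1 := by
        rw [abs_of_pos (div_pos (dpos _) (dpos _))]
        exact (dratio n).trans θ1.le
      calc _ ≤ _ := abs_add_le _ _
        _ ≤ 2 * V + 1 * (2 * V) := by rw [abs_mul]; gcongr
        _ = 4 * V := by ring
    · intro n
      have a1 := hrec n x
      have dn := (dpos n).ne'
      have dn1 := (dpos (n + 1)).ne'
      have e : birkhoffSum F u (q (n + 1)) x + d (n + 1) / d n * birkhoffSum F u (q n) x =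
          d (n + 1) / d n * ((birkhoffSum F u (q (n + 1 + 1)) x +
            d (n + 1 + 1) / d (n + 1) * birkhoffSum F u (q (n + 1)) x) -
            (birkhoffSum F u (q (n + 2)) x - birkhoffSum F u (q n) x -
              k (n + 2) * birkhoffSum F u (q (n + 1)) x)) := by
        field_simp
        rw [drec n]
        ring
      rw [e, abs_mul, abs_of_pos (div_pos (dpos _) (dpos _))]
      refine mul_le_mul (dratio n) ?_ (abs_nonneg _) θ0
      exact (abs_sub _ _).trans (add_le_add le_rfl a1)
  obtain ⟨C', hC', hmain⟩ := exists_weight_contraction (θ := θ) (s := 1 + σ)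
    (D := θ / (1 - θ) * C) (A := 2 * V) θ0 θ1 (by linarith [h.sigma_pos])
    (mul_nonneg (div_nonneg θ0 (by linarith)) hC) (by linarith)
  refine ⟨C' + 1, by linarith, fun n x => ?_⟩
  have hfin := hmain (fun n => |birkhoffSum F u (q n) x|) (h.abs_birkhoffSum_q_le 0 x) (by
    intro n
    have a1 := hw n x
    have a2 : |d (n + 1) / d n * birkhoffSum F u (q n) x| ≤ θ * |birkhoffSum F u (q n) x| := by
      rw [abs_mul, abs_of_pos (div_pos (dpos _) (dpos _))]
      exact mul_le_mul_of_nonneg_right (dratio n) (abs_nonneg _)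
    have a3 := abs_sub (birkhoffSum F u (q (n + 1)) x + d (n + 1) / d n * birkhoffSum F u (q n) x)
      (d (n + 1) / d n * birkhoffSum F u (q n) x)
    rw [add_sub_cancel_right] at a3
    linarith) n
  refine hfin.trans ?_
  gcongr
  linarith

lemma q_succ_le (n : ℕ) : q (n + 1) ≤ (K + 1) * q n := by
  have hk := h.k_le
  match n with
  | 0 => rw [h.q1, h.q0]; have := hk 0; simp at this; omega
  | n + 1 =>
    rw [h.qrec, add_mul, one_mul]
    exact add_le_add (Nat.mul_le_mul_right _ (hk (n + 1))) (h.q_le_succ n)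

lemma succ_le_q_succ (n : ℕ) : n + 1 ≤ q (n + 1) := by
  induction n with
  | zero => exact h.one_le_q 1
  | succ n ih =>
    rw [h.qrec]
    exact add_le_add (ih.trans (Nat.le_mul_of_pos_left _ (h.one_le_k (n + 1)))) (h.one_le_q n)

/-- Removing from `j` its part below `q n` in the Ostrowski numeration leaves a Birkhoff sum
controlled by those at the closest return times. -/
lemma exists_split {η : ℕ → ℝ} (hη0 : ∀ n, 0 ≤ η n)
    (hη : ∀ n x, |birkhoffSum F u (q n) x| ≤ η n) {n N : ℕ} (hnN : n ≤ N) :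
    ∀ j < q N, ∃ r < q n, ∃ j', j = r + j' ∧
      ∀ x, |birkhoffSum F u j' x| ≤ K * ∑ m ∈ Finset.Ico n N, η m := by
  induction N, hnN using Nat.le_induction with
  | base => exact fun j hj => ⟨j, hj, 0, by simp, by simp⟩
  | succ N hN ih =>
    intro j hj
    have hq := h.one_le_q N
    obtain ⟨r, hr, j', hj', hb⟩ := ih (j % q N) (Nat.mod_lt _ hq)
    refine ⟨r, hr, j' + j / q N * q N, ?_, fun x => ?_⟩
    · rw [← add_assoc, ← hj', mul_comm, Nat.mod_add_div]
    · have hdiv : j / q N ≤ K := by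
        rw [← Nat.lt_succ_iff, Nat.div_lt_iff_lt_mul hq]
        exact hj.trans_le (h.q_succ_le N)
      rw [birkhoffSum_mul, Finset.sum_Ico_succ_top hN, mul_add]
      refine (abs_add_le _ _).trans (add_le_add (hb x) ?_)
      calc _ ≤ ∑ i ∈ Finset.range (j / q N), η N :=
            (Finset.abs_sum_le_sum_abs _ _).trans (Finset.sum_le_sum fun i _ => hη N _)
        _ = (j / q N : ℕ) * η N := by simp
        _ ≤ K * η N := mul_le_mul_of_nonneg_right (by exact_mod_cast hdiv) (hη0 N)

lemma exists_tail_le : ∃ C, 0 < C ∧ ∀ n j, ∃ r < q n, ∃ j', j = r + j' ∧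
    ∀ x, |birkhoffSum F u j' x| ≤ C * ((n : ℝ) + 1) ^ (-σ) := by
  obtain ⟨C, hC, hη⟩ := h.exists_birkhoffSum_q_le
  obtain ⟨C', hC', hsum⟩ := exists_sum_weight_le h.sigma_pos
  have hK : (0 : ℝ) < K := by
    have := (h.one_le_k 0).trans (h.k_le 0)
    exact_mod_cast this
  refine ⟨K * (C * C'), by positivity, fun n j => ?_⟩
  have hj : j < q (n + j + 1) := by have := h.succ_le_q_succ (n + j); omega
  obtain ⟨r, hr, j', e, hb⟩ := h.exists_split (fun n => by positivity) hη
    (show n ≤ n + j + 1 by omega) j hj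
  refine ⟨r, hr, j', e, fun x => (hb x).trans ?_⟩
  rw [← Finset.mul_sum, mul_assoc, mul_assoc]
  gcongr
  exact hsum n _ (by omega)

lemma exists_abs_birkhoffSum_le : ∃ B, 0 ≤ B ∧ ∀ j x, |birkhoffSum F u j x| ≤ B := by
  obtain ⟨C, hC, htail⟩ := h.exists_tail_le
  refine ⟨C, hC.le, fun j x => ?_⟩
  obtain ⟨r, hr, j', e, hb⟩ := htail 0 j
  rw [h.q0, Nat.lt_one_iff] at hr
  have := hb x
  simpa [e, hr] using this

lemma exists_osc_gap_le : ∃ C, 0 < C ∧ ∀ n j x, ∀ y ∈ uIcc x (ret F p q n x),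
    |birkhoffSum F u j y - birkhoffSum F u j x| ≤ C * ((n : ℝ) + 1) ^ (-σ) := by
  obtain ⟨C, hC, hη⟩ := h.exists_birkhoffSum_q_le
  obtain ⟨C', hC', htail⟩ := h.exists_tail_le
  have hD := h.D_nonneg
  refine ⟨2 * C + 4 * D + 2 * C', by positivity, fun n j x y hy => ?_⟩
  obtain ⟨r, hr, j', e, hb⟩ := htail n j
  have hw : ((n : ℝ) + 1) ^ (-(1 + σ)) ≤ ((n : ℝ) + 1) ^ (-σ) :=
    Real.rpow_le_rpow_of_exponent_le (by linarith [n.cast_nonneg (α := ℝ)]) (by linarith)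
  have a1 := h.abs_birkhoffSum_sub_le (n := n) (hr.le.trans (h.q_le_succ n)) hy le_rfl
    (by rw [one_mul]; exact h.abs_sub_le_gap hy Set.left_mem_uIcc)
  rw [h.birkhoffSum_ret_sub_comm, sub_self, zero_div, sub_zero, one_mul] at a1
  have a2 := (abs_sub (birkhoffSum F u (q n) (F^[r] x)) (birkhoffSum F u (q n) x)).trans
    (add_le_add (hη n _) (hη n _))
  have a3 := (abs_sub (birkhoffSum F u j' (F^[r] y)) (birkhoffSum F u j' (F^[r] x))).trans
    (add_le_add (hb _) (hb _))
  have a4 : (2 * C + 4 * D) * ((n : ℝ) + 1) ^ (-(1 + σ)) ≤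
      (2 * C + 4 * D) * ((n : ℝ) + 1) ^ (-σ) := by gcongr
  rw [e, birkhoffSum_add, birkhoffSum_add, add_sub_add_comm]
  refine (abs_add_le _ _).trans ?_
  linarith

lemma exists_le_gap : ∃ c r : ℝ, 0 < c ∧ 0 < r ∧ r < 1 ∧ ∀ n x, c * r ^ n ≤ gap F p q n x := by
  obtain ⟨B, hB, hL⟩ := h.exists_abs_birkhoffSum_le
  have hit : ∀ n i x, gap F p q n (F^[i] x) ≤ Real.exp B * gap F p q n x := by
    intro n i x
    obtain ⟨ζ, -, he⟩ := h.exists_gap_iterate n i x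
    rw [he]
    exact mul_le_mul_of_nonneg_right (Real.exp_le_exp.2 (abs_le.1 (hL i ζ)).2) (h.gap_pos _ _).le
  have hit' : ∀ n i x, gap F p q n x ≤ Real.exp B * gap F p q n (F^[i] x) := by
    intro n i x
    obtain ⟨ζ, -, he⟩ := h.exists_gap_iterate n i x
    rw [he, ← mul_assoc, ← Real.exp_add]
    refine le_mul_of_one_le_left (h.gap_pos _ _).le (Real.one_le_exp_iff.2 ?_)
    linarith [(abs_le.1 (hL i ζ)).1]
  have hle : ∀ n x, gap F p q (n + 1) x ≤ Real.exp B * gap F p q n x := by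
    intro n x
    have h1 := h.gap_eq n
    have h2 : gap F p q (n + 1) (F^[q n] x) ≤ gap F p q n x := by
      rw [h1]
      have := Finset.single_le_sum
        (f := fun i => gap F p q (n + 1) (F^[q n + i * q (n + 1)] x))
        (fun i _ => (h.gap_pos _ _).le) (Finset.mem_range.2 (h.one_le_k (n + 1)))
      have h3 := h.gap_pos (n + 2) x
      simp only [zero_mul, add_zero] at this
      linarith
    exact (hit' (n + 1) (q n) x).trans (by gcongr)
  have hrec : ∀ n x, gap F p q n x ≤ (K + 1) * Real.exp B * gap F p q (n + 1) x := by
    intro n x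
    rw [h.gap_eq n x]
    have h1 : ∑ i ∈ Finset.range (k (n + 2)), gap F p q (n + 1) (F^[q n + i * q (n + 1)] x) ≤
        K * (Real.exp B * gap F p q (n + 1) x) := by
      calc _ ≤ ∑ i ∈ Finset.range (k (n + 2)), Real.exp B * gap F p q (n + 1) x :=
            Finset.sum_le_sum fun i _ => hit _ _ _
        _ = k (n + 2) * (Real.exp B * gap F p q (n + 1) x) := by simp
        _ ≤ _ := by
          refine mul_le_mul_of_nonneg_right (by exact_mod_cast h.k_le (n + 1)) ?_
          exact mul_nonneg (Real.exp_pos _).le (h.gap_pos _ _).le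
    have h2 := hle (n + 1) x
    have : n + 1 + 1 = n + 2 := rfl
    rw [this] at h2
    linarith
  have hfirst : ∀ x, 1 ≤ (q 1 + 1) * Real.exp B * Real.exp B * gap F p q 0 x := by
    intro x
    have h0 := h.gap_total 0 x
    have h1 : ∑ i ∈ Finset.range (q (0 + 1)), gap F p q 0 (F^[i] x) ≤
        q 1 * (Real.exp B * gap F p q 0 x) := by
      calc _ ≤ ∑ i ∈ Finset.range (q (0 + 1)), Real.exp B * gap F p q 0 x :=
            Finset.sum_le_sum fun i _ => hit _ _ _
        _ = _ := by simp
    have h2 : ∑ i ∈ Finset.range (q 0), gap F p q (0 + 1) (F^[i] x) = gap F p q (0 + 1) x := by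
      simp [h.q0]
    have h3 := hle 0 x
    have h4 : 1 ≤ (q 1 + 1) * (Real.exp B * gap F p q 0 x) := by linarith
    have h5 : (q 1 + 1) * (Real.exp B * gap F p q 0 x) ≤
        Real.exp B * ((q 1 + 1) * (Real.exp B * gap F p q 0 x)) :=
      le_mul_of_one_le_left (by linarith) (Real.one_le_exp hB)
    linarith
  have hK : (1 : ℝ) ≤ K := by
    have := (h.one_le_k 0).trans (h.k_le 0)
    exact_mod_cast this
  have hKB : 1 < (K + 1) * Real.exp B := by nlinarith [Real.one_le_exp hB]
  refine ⟨1 / ((q 1 + 1) * Real.exp B * Real.exp B), 1 / ((K + 1) * Real.exp B), by positivity,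
    by positivity, by rw [div_lt_one (by linarith)]; exact hKB, fun n x => ?_⟩
  induction n with
  | zero =>
    rw [pow_zero, mul_one, div_le_iff₀ (by positivity)]
    linarith [hfirst x]
  | succ n ih =>
    rw [pow_succ, ← mul_assoc, mul_one_div, div_le_iff₀ (by linarith), mul_comm (gap F p q _ x)]
    exact ih.trans (hrec n x)

theorem exists_log_modulus : ∃ C, 0 < C ∧ ∀ j x y, 0 < |x - y| → |x - y| ≤ 1 / 2 →
    |birkhoffSum F u j x - birkhoffSum F u j y| ≤ C * Real.log (1 / |x - y|) ^ (-σ) := by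
  obtain ⟨B, hB, hL⟩ := h.exists_abs_birkhoffSum_le
  obtain ⟨C, hC, hosc⟩ := h.exists_osc_gap_le
  obtain ⟨c, r, hc, hr0, hr1, hgap⟩ := h.exists_le_gap
  have hσ := h.sigma_pos
  have hlr : 0 < Real.log (1 / r) := Real.log_pos (by rw [lt_div_iff₀ hr0]; linarith)
  set A : ℝ := |Real.log (1 / c)| + Real.log (1 / r) with hA
  have hA0 : 0 < A := by positivity
  have hlog : ∀ x y : ℝ, 0 < |x - y| → |x - y| ≤ 1 / 2 → 0 < Real.log (1 / |x - y|) := by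
    intro x y h0 h1
    exact Real.log_pos (by rw [lt_div_iff₀ h0]; linarith)
  refine ⟨2 * B * A ^ σ + C * A ^ σ, by positivity, fun j x y h0 h1 => ?_⟩
  have hl := hlog x y h0 h1
  rcases lt_or_ge c |x - y| with hcase | hcase
  · have h2 : Real.log (1 / |x - y|) ≤ A := by
      have : Real.log (1 / |x - y|) ≤ Real.log (1 / c) :=
        Real.log_le_log (by positivity) (by gcongr)
      linarith [le_abs_self (Real.log (1 / c))]
    have h3 : 1 ≤ A ^ σ * Real.log (1 / |x - y|) ^ (-σ) := by
      rw [Real.rpow_neg hl.le, ← div_eq_mul_inv, ← Real.div_rpow hA0.le hl.le]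
      exact Real.one_le_rpow ((one_le_div hl).2 h2) hσ.le
    have h4 := (abs_sub (birkhoffSum F u j x) (birkhoffSum F u j y)).trans
      (add_le_add (hL j x) (hL j y))
    have h5 : 2 * B * 1 ≤ 2 * B * (A ^ σ * Real.log (1 / |x - y|) ^ (-σ)) := by gcongr
    have h6 : 0 ≤ C * A ^ σ * Real.log (1 / |x - y|) ^ (-σ) := by positivity
    linarith
  · obtain ⟨n, hn1, hn2⟩ := exists_nat_pow_near_of_lt_one (div_pos h0 hc)
      ((div_le_one hc).2 hcase) hr0 hr1
    rw [div_le_iff₀ hc] at hn2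
    rw [lt_div_iff₀ hc] at hn1
    have hadj : y ∈ uIcc x (ret F p q n x) ∨ x ∈ uIcc y (ret F p q n y) := by
      have key : ∀ z w : ℝ, 0 ≤ (-1) ^ n * (w - z) → |w - z| ≤ c * r ^ n →
          w ∈ uIcc z (ret F p q n z) := by
        intro z w hz hw
        have e : w = z + (-1) ^ n * ((-1) ^ n * (w - z)) := by
          rw [← mul_assoc, ← mul_pow]; norm_num
        have e2 : (-1) ^ n * (w - z) = |w - z| := by
          rw [← abs_of_nonneg hz, abs_mul, abs_pow, abs_neg, abs_one, one_pow, one_mul]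
        rw [e]
        exact IsReturns.mem_uIcc_ret hz (e2.trans_le (hw.trans (hgap n z)))
      have hle : |x - y| ≤ c * r ^ n := by linarith
      rcases le_total 0 ((-1) ^ n * (y - x)) with hs | hs
      · exact Or.inl (key x y hs (by rwa [abs_sub_comm]))
      · exact Or.inr (key y x (by linarith) hle)
    have h2 : |birkhoffSum F u j x - birkhoffSum F u j y| ≤ C * ((n : ℝ) + 1) ^ (-σ) := by
      rcases hadj with hy | hx
      · rw [abs_sub_comm]; exact hosc n j x y hy
      · exact hosc n j y x hx
    have h3 : Real.log (1 / |x - y|) ≤ A * (n + 1) := by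
      have h4 : Real.log (1 / |x - y|) ≤ Real.log (1 / c) + (n + 1 : ℕ) * Real.log (1 / r) := by
        rw [← Real.log_pow, ← Real.log_mul (by positivity) (by positivity)]
        apply Real.log_le_log (by positivity)
        rw [one_div_pow, one_div_mul_one_div, mul_comm c]
        exact one_div_le_one_div_of_le (by positivity) hn1.le
      push_cast at h4
      have h5 : |Real.log (1 / c)| ≤ |Real.log (1 / c)| * ((n : ℝ) + 1) :=
        le_mul_of_one_le_right (abs_nonneg _) (by linarith [n.cast_nonneg (α := ℝ)])
      have h6 := le_abs_self (Real.log (1 / c))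
      rw [hA, add_mul]
      linarith
    have h7 : ((n : ℝ) + 1) ^ (-σ) ≤ A ^ σ * Real.log (1 / |x - y|) ^ (-σ) := by
      have h8 : (A * ((n : ℝ) + 1)) ^ (-σ) ≤ Real.log (1 / |x - y|) ^ (-σ) :=
        Real.rpow_le_rpow_of_nonpos hl h3 (by linarith)
      rw [Real.mul_rpow hA0.le (by positivity)] at h8
      calc ((n : ℝ) + 1) ^ (-σ) = A ^ σ * (A ^ (-σ) * ((n : ℝ) + 1) ^ (-σ)) := by
            rw [← mul_assoc, ← Real.rpow_add hA0, add_neg_cancel, Real.rpow_zero, one_mul]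
        _ ≤ _ := by gcongr
    have h9 : C * ((n : ℝ) + 1) ^ (-σ) ≤ C * (A ^ σ * Real.log (1 / |x - y|) ^ (-σ)) := by gcongr
    have h10 : 0 ≤ 2 * B * A ^ σ * Real.log (1 / |x - y|) ^ (-σ) := by positivity
    linarith

end IsRegularReturns

lemma rot_pos {k p q : ℕ → ℕ} {ρ : ℝ} (hirr : Irrational ρ) (hqpos : ∀ n, 0 < q n)
    (hp0 : p 0 = 0) (hp1 : p 1 = 1) (hq0 : q 0 = 1)
    (hprec : ∀ n, p (n + 2) = k (n + 2) * p (n + 1) + p n)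
    (hqrec : ∀ n, q (n + 2) = k (n + 2) * q (n + 1) + q n)
    (hconv : Tendsto (fun n => (p n : ℝ) / (q n : ℝ)) atTop (𝓝 ρ)) (n : ℕ) :
    0 < (-1) ^ n * (q n * ρ - p n) := by
  have hdet : ∀ j, 0 ≤ (-1 : ℝ) ^ n * (p (n + j) * q n - p n * q (n + j)) := by
    intro j
    induction j using Nat.twoStepInduction with
    | zero => simp [mul_comm]
    | one => rw [convergents_det hp0 hp1 hq0 hprec hqrec, ← mul_pow]; norm_num
    | more j h0 h1 =>
      have e : (-1 : ℝ) ^ n * (p (n + (j + 2)) * q n - p n * q (n + (j + 2))) =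
          k (n + j + 2) * ((-1 : ℝ) ^ n * (p (n + (j + 1)) * q n - p n * q (n + (j + 1)))) +
          (-1 : ℝ) ^ n * (p (n + j) * q n - p n * q (n + j)) := by
        rw [show n + (j + 2) = n + j + 2 by ring, show n + (j + 1) = n + j + 1 by ring,
          hprec, hqrec]
        push_cast
        ring
      rw [e]
      positivity
  have hlim : Tendsto (fun j => (-1 : ℝ) ^ n * (q n * (p (j + n) / q (j + n)) - p n)) atTop
      (𝓝 ((-1 : ℝ) ^ n * (q n * ρ - p n))) :=
    ((((tendsto_add_atTop_iff_nat n).2 hconv).const_mul _).sub_const _).const_mul _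
  have hnn : 0 ≤ (-1 : ℝ) ^ n * (q n * ρ - p n) := by
    refine ge_of_tendsto' hlim fun j => ?_
    have hq : (0 : ℝ) < q (n + j) := Nat.cast_pos.2 (hqpos _)
    have e : (-1 : ℝ) ^ n * (q n * (p (j + n) / q (j + n)) - p n) =
        ((-1 : ℝ) ^ n * (p (n + j) * q n - p n * q (n + j))) / q (n + j) := by
      rw [add_comm j n]
      field_simp
    rw [e]
    exact div_nonneg (hdet j) hq.le
  refine lt_of_le_of_ne hnn fun h0 => ?_
  have h1 : (q n : ℝ) * ρ - p n = 0 := by simpa using h0.symm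
  exact ((hirr.natCast_mul (hqpos n).ne').sub_natCast (p n)).ne_zero h1

lemma mul_rot_le {F : ℝ → ℝ} {ρ : ℝ} (hF : StrictMono F) (hdeg : ∀ x, F (x + 1) = F x + 1)
    {x : ℝ} (hrot : Tendsto (fun n : ℕ => (F^[n] x - x) / (n : ℝ)) atTop (𝓝 ρ))
    {p q : ℕ} (hq : 0 < q) (hx : F^[q] x ≤ x + p) : q * ρ ≤ p := by
  have hm : ∀ m : ℕ, F^[q * m] x ≤ x + (m * p : ℕ) := by
    intro m
    induction m with
    | zero => simp
    | succ m ih =>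
      rw [mul_add_one, add_comm (q * m), Function.iterate_add_apply]
      refine ((hF.iterate q).monotone ih).trans ?_
      rw [iterate_add_nat hdeg]
      push_cast
      linarith
  have hq' : (0 : ℝ) < q := Nat.cast_pos.2 hq
  have hsub := hrot.comp (tendsto_id.const_mul_atTop' hq)
  rw [mul_comm, ← le_div_iff₀ hq']
  refine le_of_tendsto hsub ?_
  filter_upwards [eventually_gt_atTop 0] with m hm0
  have hm' : (0 : ℝ) < m := Nat.cast_pos.2 hm0
  simp only [Function.comp_apply, id]
  rw [div_le_div_iff₀ (by push_cast; positivity) hq']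
  have := hm m
  push_cast at this ⊢
  nlinarith

lemma le_mul_rot {F : ℝ → ℝ} {ρ : ℝ} (hF : StrictMono F) (hdeg : ∀ x, F (x + 1) = F x + 1)
    {x : ℝ} (hrot : Tendsto (fun n : ℕ => (F^[n] x - x) / (n : ℝ)) atTop (𝓝 ρ))
    {p q : ℕ} (hq : 0 < q) (hx : x + p ≤ F^[q] x) : p ≤ q * ρ := by
  have hm : ∀ m : ℕ, x + (m * p : ℕ) ≤ F^[q * m] x := by
    intro m
    induction m with
    | zero => simp
    | succ m ih =>
      rw [mul_add_one, add_comm (q * m), Function.iterate_add_apply]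
      refine le_trans ?_ ((hF.iterate q).monotone ih)
      rw [iterate_add_nat hdeg]
      push_cast
      linarith
  have hq' : (0 : ℝ) < q := Nat.cast_pos.2 hq
  have hsub := hrot.comp (tendsto_id.const_mul_atTop' hq)
  rw [mul_comm, ← div_le_iff₀ hq']
  refine ge_of_tendsto hsub ?_
  filter_upwards [eventually_gt_atTop 0] with m hm0
  have hm' : (0 : ℝ) < m := Nat.cast_pos.2 hm0
  simp only [Function.comp_apply, id]
  rw [div_le_div_iff₀ hq' (by push_cast; positivity)]
  have := hm m
  push_cast at this ⊢
  nlinarith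

lemma gap_pos_of_rot_pos {F : ℝ → ℝ} {ρ : ℝ} (hF : StrictMono F)
    (hdeg : ∀ x, F (x + 1) = F x + 1)
    (hrot : ∀ x, Tendsto (fun n : ℕ => (F^[n] x - x) / (n : ℝ)) atTop (𝓝 ρ))
    {p q : ℕ → ℕ} {n : ℕ} (hq : 0 < q n) (hρ : 0 < (-1) ^ n * (q n * ρ - p n)) (x : ℝ) :
    0 < gap F p q n x := by
  by_contra! hle
  unfold gap at hle
  rcases neg_one_pow_eq_or ℝ n with e | e <;> rw [e] at hρ hle
  · have := mul_rot_le hF hdeg (hrot x) hq (p := p n) (by linarith)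
    linarith
  · have := le_mul_rot hF hdeg (hrot x) hq (p := p n) (by linarith)
    linarith

/-- A continuous function of period one is bounded. -/
lemma exists_abs_le_of_periodic {f : ℝ → ℝ} (hf : Continuous f) (hper : Function.Periodic f 1) :
    ∃ M, ∀ x, |f x| ≤ M := by
  obtain ⟨M, hM⟩ := isCompact_Icc.exists_bound_of_continuousOn (s := Icc (0 : ℝ) 1) hf.continuousOn
  refine ⟨M, fun x => ?_⟩
  obtain ⟨y, hy, e⟩ := hper.exists_mem_Ico₀ one_pos x
  rw [e]
  exact hM y ⟨hy.1, hy.2.le⟩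

lemma periodic_of_hasDerivAt {f f' : ℝ → ℝ} {c : ℝ} (hf : ∀ x, HasDerivAt f (f' x) x)
    (hper : ∀ x, f (x + 1) = f x + c) : Function.Periodic f' 1 := by
  intro x
  have h1 : HasDerivAt (fun x => f (x + 1)) (f' (x + 1)) x := (hf (x + 1)).comp_add_const x 1
  have h2 : HasDerivAt (fun x => f (x + 1)) (f' x) x := by
    simp only [hper]
    exact (hf x).add_const c
  exact h1.unique h2

lemma abs_trapezoid_le {f g h : ℝ → ℝ} (hf : ∀ x, HasDerivAt f (g x) x)
    (hg : ∀ x, HasDerivAt g (h x) x) {a b W : ℝ} (hW : ∀ t ∈ uIcc a b, |h t - h a| ≤ W) :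
    |f b - f a - (b - a) * ((g a + g b) / 2)| ≤ W * |b - a| * |b - a| := by
  have hg1 : ∀ t ∈ uIcc a b, |g t - g a - (t - a) * h a| ≤ W * |t - a| := by
    intro t ht
    have hd : ∀ s ∈ uIcc a b,
        HasDerivWithinAt (fun s => g s - (s - a) * h a) (h s - h a) (uIcc a b) s := by
      intro s _
      have := (hg s).sub (((hasDerivAt_id s).sub_const a).mul_const (h a))
      exact (this.congr_deriv (by simp)).hasDerivWithinAt
    have := (convex_uIcc a b).norm_image_sub_le_of_norm_hasDerivWithin_le hd hW left_mem_uIcc ht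
    simp only [Real.norm_eq_abs] at this
    convert this using 2
    ring
  have hd : ∀ t ∈ uIcc a b, HasDerivWithinAt (fun t => f t - (t - a) * ((g a + g t) / 2))
      ((g t - g a - (t - a) * h t) / 2) (uIcc a b) t := by
    intro t _
    have := (hf t).sub (((hasDerivAt_id t).sub_const a).mul (((hg t).const_add (g a)).div_const 2))
    refine (this.congr_deriv ?_).hasDerivWithinAt
    simp only [id]
    ring
  have hb : ∀ t ∈ uIcc a b, ‖(g t - g a - (t - a) * h t) / 2‖ ≤ W * |b - a| := by
    intro t ht
    have h1 := hg1 t ht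
    have h2 : |(t - a) * (h t - h a)| ≤ W * |t - a| := by
      rw [abs_mul, mul_comm]
      exact mul_le_mul_of_nonneg_right (hW t ht) (abs_nonneg _)
    have h3 : |t - a| ≤ |b - a| := abs_sub_left_of_mem_uIcc ht
    have hW0 : 0 ≤ W := (abs_nonneg _).trans (hW t ht)
    have h4 := mul_le_mul_of_nonneg_left h3 hW0
    rw [Real.norm_eq_abs]
    rw [abs_le] at h1 h2 ⊢
    constructor <;> nlinarith
  have := (convex_uIcc a b).norm_image_sub_le_of_norm_hasDerivWithin_le hd hb left_mem_uIcc
    right_mem_uIcc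
  simp only [Real.norm_eq_abs] at this
  convert this using 2
  ring

lemma abs_log_half_exp_add_exp_le (α β : ℝ) :
    |Real.log ((Real.exp α + Real.exp β) / 2) - (α + β) / 2| ≤ (α - β) ^ 2 / 8 := by
  have e : (Real.exp α + Real.exp β) / 2 = Real.exp ((α + β) / 2) * Real.cosh ((α - β) / 2) := by
    rw [Real.cosh_eq, mul_div_assoc', mul_add, ← Real.exp_add, ← Real.exp_add]
    ring_nf
  rw [e, Real.log_mul (Real.exp_pos _).ne' (Real.cosh_pos _).ne', Real.log_exp,
    add_sub_cancel_left, abs_of_nonneg (Real.log_nonneg (Real.one_le_cosh _))]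
  have := Real.log_le_log (Real.cosh_pos _) (Real.cosh_le_exp_half_sq ((α - β) / 2))
  rw [Real.log_exp] at this
  linarith

lemma abs_log_sub_log_le {A B m : ℝ} (hm : 0 < m) (hA : m ≤ A) (hB : m ≤ B) :
    |Real.log A - Real.log B| ≤ |A - B| / m := by
  wlog hAB : B ≤ A generalizing A B
  · rw [abs_sub_comm, abs_sub_comm A]
    exact this hB hA (le_of_not_ge hAB)
  have hB0 := hm.trans_le hB
  have hA0 := hm.trans_le hA
  rw [abs_of_nonneg (sub_nonneg.2 (Real.log_le_log hB0 hAB)), abs_of_nonneg (sub_nonneg.2 hAB),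
    ← Real.log_div hA0.ne' hB0.ne']
  refine (Real.log_le_sub_one_of_pos (div_pos hA0 hB0)).trans ?_
  rw [div_sub_one hB0.ne']
  exact div_le_div_of_nonneg_left (sub_nonneg.2 hAB) hm hB

lemma abs_log_div_sub_le {F u f₂ : ℝ → ℝ} {V : ℝ} (hd : ∀ x, HasDerivAt F (Real.exp (u x)) x)
    (hd2 : ∀ x, HasDerivAt (fun x => Real.exp (u x)) (f₂ x) x) (hb : ∀ x, |u x| ≤ V)
    (hlip : ∀ x y, |u x - u y| ≤ V * |x - y|) {a b W : ℝ} (hab : a ≠ b)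
    (hW : ∀ t ∈ uIcc a b, |f₂ t - f₂ a| ≤ W) :
    |Real.log ((F b - F a) / (b - a)) - (u b + u a) / 2| ≤
      (Real.exp V * W + V ^ 2 / 8 * |b - a|) * |b - a| := by
  have hba : 0 < |b - a| := abs_pos.2 (sub_ne_zero.2 hab.symm)
  have hne : b - a ≠ 0 := sub_ne_zero.2 hab.symm
  have hexp : ∀ x, Real.exp (-V) ≤ Real.exp (u x) := fun x =>
    Real.exp_le_exp.2 (abs_le.1 (hb x)).1
  have havg : Real.exp (-V) ≤ (F b - F a) / (b - a) := by
    have hmono : Monotone fun x => F x - Real.exp (-V) * x := by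
      refine monotone_of_hasDerivAt_nonneg (f' := fun x => Real.exp (u x) - Real.exp (-V)) ?_ ?_
      · intro x
        exact ((hd x).sub ((hasDerivAt_id x).const_mul (Real.exp (-V)))).congr_deriv (by simp)
      · intro x
        exact sub_nonneg.2 (hexp x)
    rcases lt_or_gt_of_ne hab with h1 | h1
    · rw [le_div_iff₀ (by linarith)]
      have := hmono h1.le
      simp only at this
      linarith
    · rw [le_div_iff_of_neg (by linarith)]
      have := hmono h1.le
      simp only at this
      linarith
  have h1 := abs_trapezoid_le hd hd2 hW
  have h2 : |(F b - F a) / (b - a) - (Real.exp (u b) + Real.exp (u a)) / 2| ≤ W * |b - a| := by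
    have e : (F b - F a) / (b - a) - (Real.exp (u b) + Real.exp (u a)) / 2 =
        (F b - F a - (b - a) * ((Real.exp (u a) + Real.exp (u b)) / 2)) / (b - a) := by
      field_simp
      ring
    rw [e, abs_div, div_le_iff₀ hba]
    exact h1
  have h3 := abs_log_sub_log_le (Real.exp_pos _) havg
    (B := (Real.exp (u b) + Real.exp (u a)) / 2) (by linarith [hexp a, hexp b])
  rw [Real.exp_neg, div_inv_eq_mul] at h3
  have h4 := abs_log_half_exp_add_exp_le (u b) (u a)
  have h5 : (u b - u a) ^ 2 ≤ V ^ 2 * |b - a| ^ 2 := by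
    rw [← mul_pow, ← sq_abs]
    exact pow_le_pow_left₀ (abs_nonneg _) (hlip b a) 2
  have h6 := mul_le_mul_of_nonneg_right h2 (Real.exp_pos V).le
  have h7 := abs_sub_le (Real.log ((F b - F a) / (b - a)))
    (Real.log ((Real.exp (u b) + Real.exp (u a)) / 2)) ((u b + u a) / 2)
  nlinarith

lemma exists_pow_le_rpow {μ s : ℝ} (h0 : 0 < μ) (h1 : μ < 1) :
    ∃ C, 0 ≤ C ∧ ∀ n : ℕ, μ ^ n ≤ C * ((n : ℝ) + 1) ^ (-s) := by
  have hb : 0 < -Real.log μ := neg_pos.2 (Real.log_neg h0 h1)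
  have ht := (tendsto_rpow_mul_exp_neg_mul_atTop_nhds_zero s _ hb).comp
    ((tendsto_add_atTop_iff_nat 1).2 tendsto_natCast_atTop_atTop)
  obtain ⟨M, hM⟩ := ht.bddAbove_range
  have hM' : ∀ n : ℕ, ((n : ℝ) + 1) ^ s * μ ^ (n + 1) ≤ M := by
    intro n
    have := hM ⟨n, rfl⟩
    simp only [Function.comp_apply, neg_neg] at this
    rw [← Real.rpow_def_of_pos h0, Real.rpow_natCast] at this
    exact_mod_cast this
  refine ⟨M / μ, ?_, fun n => ?_⟩
  · refine div_nonneg (le_trans ?_ (hM' 0)) h0.le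
    positivity
  · rw [Real.rpow_neg (by positivity), ← div_eq_mul_inv, le_div_iff₀ (by positivity),
      le_div_iff₀ h0]
    have := hM' n
    rw [pow_succ] at this
    linarith

lemma exists_modulus_le {f : ℝ → ℝ} {σ c₀ C μ M : ℝ} (hσ : 0 < σ) (hc₀ : 0 < c₀) (hC : 0 < C)
    (h0 : 0 < μ) (h1 : μ < 1) (hM : ∀ x, |f x| ≤ M)
    (hf : ∀ x y : ℝ, 0 < |x - y| → |x - y| ≤ 1 / 2 →
      |f x - f y| ≤ c₀ * (Real.log (1 / |x - y|)) ^ (-(1 + σ))) :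
    ∃ D, 0 ≤ D ∧ ∀ (n : ℕ) x y, |x - y| ≤ C * μ ^ n →
      |f x - f y| ≤ D * ((n : ℝ) + 1) ^ (-(1 + σ)) := by
  have hM0 : 0 ≤ M := (abs_nonneg _).trans (hM 0)
  set c := -Real.log μ / 2 with hc
  have hc0 : 0 < c := by have := Real.log_neg h0 h1; linarith
  have hev : ∀ᶠ n : ℕ in atTop, C * μ ^ n ≤ 1 / 2 ∧ c * (n + 1) ≤ Real.log (1 / (C * μ ^ n)) := by
    have t1 : Tendsto (fun n : ℕ => C * μ ^ n) atTop (𝓝 0) := by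
      simpa using (tendsto_pow_atTop_nhds_zero_of_lt_one h0.le h1).const_mul C
    refine ((t1.eventually_lt_const (by norm_num : (0 : ℝ) < 1 / 2)).mono fun _ h => h.le).and ?_
    obtain ⟨N, hN⟩ := exists_nat_ge ((Real.log C + c) / c)
    filter_upwards [eventually_ge_atTop N] with n hn
    have hn' : (N : ℝ) ≤ n := by exact_mod_cast hn
    rw [div_le_iff₀ hc0] at hN
    rw [one_div, Real.log_inv, Real.log_mul hC.ne' (pow_pos h0 n).ne', Real.log_pow]
    have : Real.log μ = -(2 * c) := by rw [hc]; ring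
    rw [this]
    nlinarith
  obtain ⟨N, hN⟩ := eventually_atTop.1 hev
  refine ⟨2 * M * ((N : ℝ) + 1) ^ (1 + σ) + c₀ * c ^ (-(1 + σ)), by positivity,
    fun n x y hxy => ?_⟩
  rw [add_mul]
  rcases lt_or_ge n N with hn | hn
  · have hle : |f x - f y| ≤ 2 * M := by
      have := abs_sub (f x) (f y)
      linarith [hM x, hM y]
    have : (1 : ℝ) ≤ ((N : ℝ) + 1) ^ (1 + σ) * ((n : ℝ) + 1) ^ (-(1 + σ)) := by
      rw [Real.rpow_neg (by positivity), ← div_eq_mul_inv, one_le_div (by positivity)]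
      refine Real.rpow_le_rpow (by positivity) ?_ (by positivity)
      have : (n : ℝ) ≤ N := by exact_mod_cast hn.le
      linarith
    have h2 : 0 ≤ c₀ * c ^ (-(1 + σ)) * ((n : ℝ) + 1) ^ (-(1 + σ)) := by positivity
    have h3 := mul_le_mul_of_nonneg_left this (by positivity : 0 ≤ 2 * M)
    nlinarith
  · obtain ⟨h2, h3⟩ := hN n hn
    have h4 : 0 ≤ 2 * M * ((N : ℝ) + 1) ^ (1 + σ) * ((n : ℝ) + 1) ^ (-(1 + σ)) := by positivity
    refine le_trans ?_ (le_add_of_nonneg_left h4)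
    rcases (abs_nonneg (x - y)).eq_or_lt with h5 | h5
    · have : x = y := sub_eq_zero.1 (abs_eq_zero.1 h5.symm)
      rw [this, sub_self, abs_zero]
      positivity
    · refine (hf x y h5 (hxy.trans h2)).trans ?_
      rw [mul_assoc, ← Real.mul_rpow hc0.le (by positivity)]
      refine mul_le_mul_of_nonneg_left ?_ hc₀.le
      refine Real.rpow_le_rpow_of_nonpos (by positivity) (h3.trans ?_) (by linarith)
      exact Real.log_le_log (by positivity) (one_div_le_one_div_of_le h5 hxy)

lemma continuous_of_log_modulus {g : ℝ → ℝ} {C σ : ℝ} (hσ : 0 < σ)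
    (hg : ∀ x y, 0 < |x - y| → |x - y| ≤ 1 / 2 →
      |g x - g y| ≤ C * Real.log (1 / |x - y|) ^ (-σ)) : Continuous g := by
  refine continuous_iff_continuousAt.2 fun y => continuousAt_iff_punctured_nhds.2 ?_
  have h0 : Tendsto (fun x => |x - y|) (𝓝[≠] y) (𝓝[>] 0) := by
    refine tendsto_nhdsWithin_iff.2 ⟨?_, ?_⟩
    · have : Continuous fun x : ℝ => |x - y| := by fun_prop
      simpa using (this.tendsto y).mono_left nhdsWithin_le_nhds
    · filter_upwards [self_mem_nhdsWithin] with x hx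
      exact abs_pos.2 (sub_ne_zero.2 hx)
  have h1 : Tendsto (fun x => C * Real.log (1 / |x - y|) ^ (-σ)) (𝓝[≠] y) (𝓝 0) := by
    have : Tendsto (fun x => Real.log (1 / |x - y|)) (𝓝[≠] y) atTop := by
      simp only [one_div]
      exact Real.tendsto_log_atTop.comp (tendsto_inv_nhdsGT_zero.comp h0)
    simpa using ((tendsto_rpow_neg_atTop hσ).comp this).const_mul C
  rw [tendsto_iff_norm_sub_tendsto_zero]
  refine squeeze_zero' (Eventually.of_forall fun x => norm_nonneg _) ?_ h1
  have h2 := h0.eventually (Ioc_mem_nhdsGT (by norm_num : (0 : ℝ) < 1 / 2))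
  filter_upwards [h2] with x hx
  exact hg x y hx.1 hx.2

/-- A continuous solution `g` of `g ∘ F = g - u`, where `u` is the logarithm of the derivative of
`F`, integrates to a `C¹` conjugacy. -/
lemma exists_conjugacy {F u g : ℝ → ℝ} {ρ : ℝ} (hd : ∀ x, HasDerivAt F (Real.exp (u x)) x)
    (hrot : Tendsto (fun n : ℕ => (F^[n] 0 - 0) / (n : ℝ)) atTop (𝓝 ρ))
    (hg : Continuous g) (hper : Function.Periodic g 1) (hF : ∀ x, g (F x) = g x - u x) :
    ∃ (Φ : ℝ → ℝ) (Z : ℝ), 0 < Z ∧ (∀ x, HasDerivAt Φ (Real.exp (g x) / Z) x) ∧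
      (∀ x, Φ (x + 1) = Φ x + 1) ∧ ∀ x, Φ (F x) = Φ x + ρ := by
  have hcont : Continuous fun x => Real.exp (g x) := Real.continuous_exp.comp hg
  set Z := ∫ x in (0 : ℝ)..1, Real.exp (g x)
  have hZ : 0 < Z := intervalIntegral.intervalIntegral_pos_of_pos
    (hcont.intervalIntegrable _ _) (fun x => Real.exp_pos _) one_pos
  set Φ : ℝ → ℝ := fun x => (∫ t in (0 : ℝ)..x, Real.exp (g t)) / Z with hΦ
  have hΦd : ∀ x, HasDerivAt Φ (Real.exp (g x) / Z) x := fun x =>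
    (hcont.integral_hasStrictDerivAt 0 x).hasDerivAt.div_const Z
  have hΦdeg : ∀ x, Φ (x + 1) = Φ x + 1 := by
    intro x
    have hp : Function.Periodic (fun x => Real.exp (g x)) 1 := fun x => by
      simp only [hper x]
    have h1 := intervalIntegral.integral_add_adjacent_intervals
      (hcont.intervalIntegrable 0 x) (hcont.intervalIntegrable x (x + 1))
      (μ := MeasureTheory.volume)
    have h2 := hp.intervalIntegral_add_eq x 0
    rw [zero_add] at h2
    simp only [hΦ]
    rw [← h1, h2, add_div, div_self hZ.ne']
  have hconst : ∀ x, Φ (F x) - Φ x = Φ (F 0) - Φ 0 := by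
    have hderiv : ∀ x, HasDerivAt (fun x => Φ (F x) - Φ x) 0 x := by
      intro x
      refine (((hΦd (F x)).comp x (hd x)).sub (hΦd x)).congr_deriv ?_
      rw [hF, div_mul_eq_mul_div, ← Real.exp_add, sub_add_cancel, sub_self]
    intro x
    exact is_const_of_deriv_eq_zero (fun x => (hderiv x).differentiableAt)
      (fun x => (hderiv x).deriv) x 0
  set c := Φ (F 0) - Φ 0
  have hiter : ∀ n : ℕ, Φ (F^[n] 0) = Φ 0 + n * c := by
    intro n
    induction n with
    | zero => simp
    | succ n ih =>
      rw [Function.iterate_succ_apply']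
      have := hconst (F^[n] 0)
      push_cast
      linarith
  obtain ⟨M, hM⟩ := exists_abs_le_of_periodic (f := fun x => Φ x - x)
    ((continuous_iff_continuousAt.2 fun x => (hΦd x).continuousAt).sub continuous_id)
    (fun x => by simp only [hΦdeg]; ring)
  have hlim : Tendsto (fun n : ℕ => (F^[n] 0 - 0) / (n : ℝ)) atTop (𝓝 c) := by
    rw [tendsto_iff_norm_sub_tendsto_zero]
    refine squeeze_zero' (Eventually.of_forall fun x => norm_nonneg _) ?_
      (tendsto_const_div_atTop_nhds_zero_nat (2 * M))
    filter_upwards [eventually_gt_atTop 0] with n hn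
    have hn' : (0 : ℝ) < n := Nat.cast_pos.2 hn
    have e : (F^[n] 0 - 0) / (n : ℝ) - c = ((Φ 0 - 0) - (Φ (F^[n] 0) - F^[n] 0)) / n := by
      rw [hiter n]
      field_simp
      ring
    rw [e, Real.norm_eq_abs, abs_div, abs_of_pos hn']
    refine div_le_div_of_nonneg_right ?_ hn'.le
    have := abs_sub (Φ 0 - 0) (Φ (F^[n] 0) - F^[n] 0)
    linarith [hM 0, hM (F^[n] 0)]
  refine ⟨Φ, Z, hZ, hΦd, hΦdeg, fun x => ?_⟩
  rw [tendsto_nhds_unique hrot hlim, ← hconst x]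
  ring

/-- The upper limit of the Birkhoff sums solves the cohomological equation `g ∘ F = g - u`. -/
lemma IsRegularReturns.exists_cohomology {F u : ℝ → ℝ} {k p q : ℕ → ℕ} {V ρ σ D : ℝ} {K : ℕ}
    (h : IsRegularReturns F u k p q V ρ σ D K) :
    ∃ (g : ℝ → ℝ) (B C : ℝ), 0 < C ∧ (∀ x, |g x| ≤ B) ∧ Function.Periodic g 1 ∧
      (∀ x, g (F x) = g x - u x) ∧ ∀ x y, 0 < |x - y| → |x - y| ≤ 1 / 2 →
        |g x - g y| ≤ C * Real.log (1 / |x - y|) ^ (-σ) := by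
  obtain ⟨B, -, hB⟩ := h.exists_abs_birkhoffSum_le
  obtain ⟨C, hC, hmod⟩ := h.exists_log_modulus
  set S := birkhoffSum F u
  have hup : ∀ x, IsBoundedUnder (· ≤ ·) atTop fun j => S j x := fun x =>
    isBoundedUnder_of ⟨B, fun j => (abs_le.1 (hB j x)).2⟩
  have hlow : ∀ x, IsCoboundedUnder (· ≤ ·) atTop fun j => S j x := fun x =>
    IsBoundedUnder.isCoboundedUnder_le (isBoundedUnder_of ⟨-B, fun j => (abs_le.1 (hB j x)).1⟩)
  have hle : ∀ x y E, (∀ j, S j x ≤ S j y + E) →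
      limsup (fun j => S j x) atTop ≤ limsup (fun j => S j y) atTop + E := by
    intro x y E hE
    rw [← limsup_add_const _ _ _ (hup y) (hlow y)]
    exact limsup_le_limsup (Eventually.of_forall hE) (hlow x)
      (isBoundedUnder_of ⟨B + E, fun j => by linarith [(abs_le.1 (hB j y)).2]⟩)
  refine ⟨fun x => limsup (fun j => S j x) atTop, B, C, hC, fun x => ?_, fun x => ?_,
    fun x => ?_, fun x y h0 h1 => ?_⟩
  · refine abs_le.2 ⟨?_, ?_⟩
    · exact le_limsup_of_frequently_le
        (Frequently.of_forall fun j => (abs_le.1 (hB j x)).1) (hup x)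
    · exact limsup_le_of_le (hlow x) (Eventually.of_forall fun j => (abs_le.1 (hB j x)).2)
  · have : ∀ j, S j (x + 1) = S j x := fun j => by
      have := birkhoffSum_sub_nat h.deg h.periodic j 1 (x + 1)
      simpa [S] using this.symm
    simp only [this]
  · have hS : ∀ j, S j (F x) = S (j + 1) x + -u x := fun j => by
      simp only [S, birkhoffSum_succ']
      ring
    simp only [hS]
    rw [limsup_nat_add (fun j => S j x + -u x) 1, limsup_add_const _ _ _ (hup x) (hlow x),
      sub_eq_add_neg]
  · have hE := fun j => abs_le.1 (hmod j x y h0 h1)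
    have h2 := hle x y (C * Real.log (1 / |x - y|) ^ (-σ)) fun j => by linarith [(hE j).2]
    have h3 := hle y x (C * Real.log (1 / |x - y|) ^ (-σ)) fun j => by linarith [(hE j).1]
    exact abs_le.2 ⟨by linarith, by linarith⟩

lemma abs_exp_sub_exp_le {a b B : ℝ} (ha : a ≤ B) (hb : b ≤ B) :
    |Real.exp a - Real.exp b| ≤ Real.exp B * |a - b| := by
  wlog hab : b ≤ a generalizing a b
  · rw [abs_sub_comm, abs_sub_comm a]
    exact this hb ha (le_of_not_ge hab)
  rw [abs_of_nonneg (sub_nonneg.2 (Real.exp_le_exp.2 hab)), abs_of_nonneg (sub_nonneg.2 hab)]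
  have h1 := Real.add_one_le_exp (b - a)
  have h2 : Real.exp b = Real.exp a * Real.exp (b - a) := by rw [← Real.exp_add]; ring_nf
  have h3 := mul_le_mul_of_nonneg_left h1 (Real.exp_pos a).le
  have h4 := mul_le_mul_of_nonneg_right (Real.exp_le_exp.2 ha) (sub_nonneg.2 hab)
  nlinarith

/-- The logarithm of the derivative of a `C²` lift is bounded and Lipschitz. -/
lemma exists_log_deriv_bound {f f' : ℝ → ℝ} (hf : ∀ x, HasDerivAt f (f' x) x)
    (hf' : Continuous f') (hpos : ∀ x, 0 < f x) (hper : Function.Periodic f 1) :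
    ∃ V, (∀ x, |Real.log (f x)| ≤ V) ∧
      ∀ x y, |Real.log (f x) - Real.log (f y)| ≤ V * |x - y| := by
  have hcont : Continuous f := continuous_iff_continuousAt.2 fun x => (hf x).continuousAt
  have hper' : Function.Periodic f' 1 :=
    periodic_of_hasDerivAt hf (c := 0) (by simpa using hper)
  obtain ⟨V₁, h1⟩ := exists_abs_le_of_periodic (f := fun x => Real.log (f x))
    (hcont.log fun x => (hpos x).ne')
    (fun x => by simp only [hper x])
  obtain ⟨V₂, h2⟩ := exists_abs_le_of_periodic (f := fun x => f' x / f x)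
    (hf'.div hcont fun x => (hpos x).ne')
    (fun x => by simp only [hper x, hper' x])
  refine ⟨max V₁ V₂, fun x => (h1 x).trans (le_max_left _ _), fun x y => ?_⟩
  have := convex_univ.norm_image_sub_le_of_norm_hasDerivWithin_le (C := V₂)
    (fun z _ => ((hf z).log (hpos z).ne').hasDerivWithinAt) (fun z _ => h2 z)
    (mem_univ y) (mem_univ x)
  exact this.trans (mul_le_mul_of_nonneg_right (le_max_right _ _) (norm_nonneg _))

lemma exists_isRegularReturns {F F' F'' : ℝ → ℝ} (hF : StrictMono F)
    (hFp : ∀ x, F (x + 1) = F x + 1) (hF' : ∀ x, HasDerivAt F (F' x) x)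
    (hF'' : ∀ x, HasDerivAt F' (F'' x) x) (hF''cont : Continuous F'') (hF'pos : ∀ x, 0 < F' x)
    {ρ : ℝ} (hirr : Irrational ρ)
    (hrot : ∀ x, Tendsto (fun n : ℕ => (F^[n] x - x) / (n : ℝ)) atTop (𝓝 ρ))
    {k p q : ℕ → ℕ} (hk : ∀ n, 1 ≤ k (n + 1))
    (hp0 : p 0 = 0) (hp1 : p 1 = 1) (hq0 : q 0 = 1) (hq1 : q 1 = k 1)
    (hprec : ∀ n, p (n + 2) = k (n + 2) * p (n + 1) + p n)
    (hqrec : ∀ n, q (n + 2) = k (n + 2) * q (n + 1) + q n)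
    (hconv : Tendsto (fun n => (p n : ℝ) / (q n : ℝ)) atTop (𝓝 ρ))
    {K : ℕ} (hkK : ∀ n, k (n + 1) ≤ K) {σ c₀ : ℝ} (hσ : 0 < σ) (hc₀ : 0 < c₀)
    (hlogHolder : ∀ x y : ℝ, 0 < |x - y| → |x - y| ≤ 1 / 2 →
      |F'' x - F'' y| ≤ c₀ * (Real.log (1 / |x - y|)) ^ (-(1 + σ))) :
    ∃ V D, IsRegularReturns F (fun x => Real.log (F' x)) k p q V ρ σ D K := by
  have hqpos := q_pos hk hq0 hq1 hqrec
  have hrotpos := rot_pos hirr hqpos hp0 hp1 hq0 hprec hqrec hconv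
  have hper' : Function.Periodic F' 1 := periodic_of_hasDerivAt hF' hFp
  have hper'' : Function.Periodic F'' 1 :=
    periodic_of_hasDerivAt hF'' (c := 0) (by simpa using hper')
  have hexp : (fun x => Real.exp (Real.log (F' x))) = F' :=
    funext fun x => Real.exp_log (hF'pos x)
  obtain ⟨V, hV, hlip⟩ := exists_log_deriv_bound hF'' hF''cont hF'pos hper'
  have hs : IsSmoothReturns F (fun x => Real.log (F' x)) k p q V :=
    { mono := hF, deg := hFp, one_le_k := hk, p0 := hp0, p1 := hp1, q0 := hq0, q1 := hq1
      prec := hprec, qrec := hqrec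
      gap_pos := fun n => gap_pos_of_rot_pos hF hFp hrot (hqpos n) (hrotpos n)
      hasDerivAt := fun x => by rw [Real.exp_log (hF'pos x)]; exact hF' x
      periodic := fun x => by rw [hper' x]
      bound := hV
      lip := hlip }
  obtain ⟨μ, C, h0, h1, hC, hgap⟩ := hs.exists_gap_le
  obtain ⟨M, hM⟩ := exists_abs_le_of_periodic hF''cont hper''
  obtain ⟨D₁, hD₁, hmod⟩ := exists_modulus_le hσ hc₀ hC h0 h1 hM hlogHolder
  obtain ⟨D₂, hD₂, hpow⟩ := exists_pow_le_rpow (s := 1 + σ) h0 h1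
  refine ⟨V, Real.exp V * D₁ + V ^ 2 / 8 * (C * D₂), hs, hσ, by positivity, hkK, hrotpos, ?_⟩
  intro n x y z hy hz hyz
  have hyz' : |y - z| ≤ C * μ ^ n := (hs.abs_sub_le_gap hy hz).trans (hgap n x)
  refine (abs_log_div_sub_le hs.hasDerivAt (f₂ := F'') (by rw [hexp]; exact hF'') hV hlip
    hyz.symm (W := D₁ * ((n : ℝ) + 1) ^ (-(1 + σ))) fun t ht => hmod n t z ?_).trans ?_
  · exact (abs_sub_left_of_mem_uIcc ht).trans hyz'
  · refine mul_le_mul_of_nonneg_right ?_ (abs_nonneg _)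
    have h2 := mul_le_mul_of_nonneg_left (hyz'.trans (mul_le_mul_of_nonneg_left (hpow n) hC.le))
      (by positivity : 0 ≤ V ^ 2 / 8)
    linarith

end CircleReturns


/-- 1-type irrationality, logarithmic Hölder case: if all the partial quotients
of `ρ` lie in a finite set `{K₁,…,K_ν}` with asymptotic frequencies `p_j`, and
`|F″(x) − F″(y)| ≤ c₀ (log(1/|x−y|))^{−1−σ}`, then `T` admits a `C¹` conjugacy
`Φ` to `R_ρ` with `|Φ′(x) − Φ′(y)| ≤ C (log(1/|x−y|))^{−σ}`. -/
theorem one_type_irrationality_log_Holder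
    (F F' F'' : ℝ → ℝ) (hF : StrictMono F) (hFp : ∀ x, F (x + 1) = F x + 1)
    (hF' : ∀ x, HasDerivAt F (F' x) x) (hF'' : ∀ x, HasDerivAt F' (F'' x) x)
    (hF''cont : Continuous F'') (hF'pos : ∀ x, 0 < F' x)
    (ρ : ℝ) (hρ : ρ ∈ Set.Ioo (0:ℝ) 1) (hirr : Irrational ρ)
    (hrot : ∀ x : ℝ,
      Filter.Tendsto (fun n : ℕ => (F^[n] x - x) / (n : ℝ)) Filter.atTop (nhds ρ))
    (k p q : ℕ → ℕ) (hk : ∀ n, 1 ≤ k (n + 1))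
    (hp0 : p 0 = 0) (hp1 : p 1 = 1) (hq0 : q 0 = 1) (hq1 : q 1 = k 1)
    (hprec : ∀ n, p (n + 2) = k (n + 2) * p (n + 1) + p n)
    (hqrec : ∀ n, q (n + 2) = k (n + 2) * q (n + 1) + q n)
    (hconv : Filter.Tendsto (fun n => (p n : ℝ) / (q n : ℝ)) Filter.atTop (nhds ρ))
    (ν : ℕ) (hν : 2 ≤ ν) (K : Fin ν → ℕ) (hKpos : ∀ j, 1 ≤ K j)
    (hKinj : Function.Injective K)
    (hkmem : ∀ n : ℕ, 1 ≤ n → ∃ j, k n = K j)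
    (pfreq : Fin ν → ℝ) (hpf : ∀ j, pfreq j ∈ Set.Ioo (0:ℝ) 1)
    (hpfsum : ∑ j, pfreq j = 1)
    (hfreq : ∀ j, Filter.Tendsto
      (fun N : ℕ => (((Finset.Icc 1 N).filter fun n => k n = K j).card : ℝ) / N)
      Filter.atTop (nhds (pfreq j)))
    (σ c₀ : ℝ) (hσ : 0 < σ) (hc₀ : 0 < c₀)
    (hlogHolder : ∀ x y : ℝ, 0 < |x - y| → |x - y| ≤ 1 / 2 →
      |F'' x - F'' y| ≤ c₀ * (Real.log (1 / |x - y|)) ^ (-(1 + σ))) :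
    ∃ Φ Φ' : ℝ → ℝ, Continuous Φ' ∧ (∀ x, 0 < Φ' x) ∧
      (∀ x, HasDerivAt Φ (Φ' x) x) ∧
      (∀ x, Φ (x + 1) = Φ x + 1) ∧
      (∀ x, Φ (F x) = Φ x + ρ) ∧
      ∃ C > 0, ∀ x y : ℝ, 0 < |x - y| → |x - y| ≤ 1 / 2 →
        |Φ' x - Φ' y| ≤ C * (Real.log (1 / |x - y|)) ^ (-σ) := by
  obtain ⟨V, D, h⟩ := CircleReturns.exists_isRegularReturns hF hFp hF' hF'' hF''cont hF'pos hirr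
    hrot hk hp0 hp1 hq0 hq1 hprec hqrec hconv (K := Finset.univ.sup K)
    (fun n => by
      obtain ⟨j, hj⟩ := hkmem (n + 1) n.succ_pos
      rw [hj]
      exact Finset.le_sup (Finset.mem_univ j))
    hσ hc₀ hlogHolder
  obtain ⟨g, B, C, hC, hB, hper, hcoh, hmod⟩ := h.exists_cohomology
  have hg := CircleReturns.continuous_of_log_modulus hσ hmod
  obtain ⟨Φ, Z, hZ, hd, hdeg, hconj⟩ :=
    CircleReturns.exists_conjugacy h.hasDerivAt (hrot 0) hg hper hcoh
  refine ⟨Φ, fun x => Real.exp (g x) / Z, (Real.continuous_exp.comp hg).div_const Z,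
    fun x => div_pos (Real.exp_pos _) hZ, hd, hdeg, hconj, Real.exp B * C / Z, by positivity,
    fun x y h0 h1 => ?_⟩
  rw [← sub_div, abs_div, abs_of_pos hZ, div_mul_eq_mul_div, mul_assoc]
  refine div_le_div_of_nonneg_right ?_ hZ.le
  refine (CircleReturns.abs_exp_sub_exp_le (abs_le.1 (hB x)).2 (abs_le.1 (hB y)).2).trans ?_
  exact mul_le_mul_of_nonneg_left (hmod x y h0 h1) (Real.exp_pos _).le
end

section
/- Let (Kₙ)_{n≥1} be a sequence of nonnegative real numbers with Σ_{n=1}^{∞} Kₙ log n < +∞. Then for Lebesgue-almost every ρ ∈ (0,1), the series Σ_{n=1}^{∞} kₙ(ρ) Kₙ converges, where kₙ(ρ) denotes the n-th partial quotient of the continued fraction expansion ρ = [k₁(ρ), k₂(ρ), …] of the irrational number ρ. -/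
open MeasureTheory Set Filter Topology
open scoped ENNReal

/-- The Gauss map `x ↦ {1/x}`. -/
noncomputable def gaussMap (x : ℝ) : ℝ := Int.fract x⁻¹

theorem measurable_gaussMap : Measurable gaussMap :=
  measurable_fract.comp measurable_inv

theorem tsum_ofReal_inv_mul_inv {y : ℝ} (hy : 0 ≤ y) :
    ∑' k : ℕ, ENNReal.ofReal ((k + 1 + y)⁻¹ * (k + 2 + y)⁻¹) = ENNReal.ofReal (1 + y)⁻¹ := by
  have hs : HasSum (fun k : ℕ => (k + 1 + y)⁻¹ * (k + 2 + y)⁻¹) (1 + y)⁻¹ := by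
    rw [hasSum_iff_tendsto_nat_of_nonneg (fun k => by positivity)]
    have h1 : ∀ n : ℕ, ∑ k ∈ Finset.range n, ((k + 1 + y)⁻¹ * (k + 2 + y)⁻¹) =
        (1 + y)⁻¹ - (n + (1 + y))⁻¹ := by
      intro n
      induction n with
      | zero => simp
      | succ n ih =>
        rw [Finset.sum_range_succ, ih]
        push_cast
        field_simp
        ring
    simp_rw [h1]
    have h2 : Tendsto (fun n : ℕ => ((n : ℝ) + (1 + y))⁻¹) atTop (𝓝 0) :=
      tendsto_inv_atTop_zero.comp
        (tendsto_atTop_add_const_right _ _ tendsto_natCast_atTop_atTop)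
    simpa using h2.const_sub (1 + y)⁻¹
  rw [← hs.tsum_eq, ENNReal.ofReal_tsum_of_nonneg (fun k => by positivity) hs.summable]

theorem lintegral_comp_gaussMap_mul_le {g : ℝ → ℝ≥0∞} (hg : Measurable g) :
    ∫⁻ x in Ioo (0 : ℝ) 1, g (gaussMap x) * ENNReal.ofReal (1 + x)⁻¹ ≤
      ∫⁻ x in Ioo (0 : ℝ) 1, g x * ENNReal.ofReal (1 + x)⁻¹ := by
  have hcov : Ioo (0 : ℝ) 1 ⊆ ⋃ k : ℕ, (fun y : ℝ => (k + 1 + y)⁻¹) '' Ico (0 : ℝ) 1 := by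
    intro x hx
    have h1 : 1 < x⁻¹ := (one_lt_inv₀ hx.1).2 hx.2
    have h2 : 1 ≤ ⌊x⁻¹⌋₊ := Nat.le_floor (by simpa using h1.le)
    have h3 := Nat.floor_le (a := x⁻¹) (by linarith)
    have h4 := Nat.lt_floor_add_one x⁻¹
    refine mem_iUnion.2 ⟨⌊x⁻¹⌋₊ - 1, x⁻¹ - ⌊x⁻¹⌋₊, ⟨by linarith, by linarith⟩, ?_⟩
    simp [Nat.cast_sub h2]
  have hpiece : ∀ k : ℕ, ∫⁻ x in (fun y : ℝ => (k + 1 + y)⁻¹) '' Ico (0 : ℝ) 1,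
      g (gaussMap x) * ENNReal.ofReal (1 + x)⁻¹ =
      ∫⁻ y in Ico (0 : ℝ) 1, g y * ENNReal.ofReal ((k + 1 + y)⁻¹ * (k + 2 + y)⁻¹) := by
    intro k
    rw [lintegral_image_eq_lintegral_abs_deriv_mul (f' := fun y => -1 / (k + 1 + y) ^ 2)
      measurableSet_Ico]
    · refine setLIntegral_congr_fun measurableSet_Ico fun y hy => ?_
      have hy0 : 0 ≤ y := hy.1
      have hT : gaussMap ((k + 1 + y)⁻¹) = y := by
        have h : ((k : ℝ) + 1 + y) = ((k + 1 : ℕ) : ℝ) + y := by push_cast; ring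
        rw [gaussMap, inv_inv, h, Int.fract_natCast_add, Int.fract_eq_self.2 hy]
      simp only [hT]
      rw [mul_left_comm, ← ENNReal.ofReal_mul (abs_nonneg _)]
      congr 2
      rw [abs_div, abs_neg, abs_one, abs_of_nonneg (by positivity)]
      field_simp
      ring
    · intro y hy
      have hy0 : 0 ≤ y := hy.1
      exact (((hasDerivAt_id y).const_add ((k : ℝ) + 1)).inv (by simp; positivity)).hasDerivWithinAt
    · intro a _ b _ hab
      simpa using hab
  calc ∫⁻ x in Ioo (0 : ℝ) 1, g (gaussMap x) * ENNReal.ofReal (1 + x)⁻¹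
      ≤ ∫⁻ x in ⋃ k : ℕ, (fun y : ℝ => (k + 1 + y)⁻¹) '' Ico (0 : ℝ) 1,
          g (gaussMap x) * ENNReal.ofReal (1 + x)⁻¹ := lintegral_mono_set hcov
    _ ≤ ∑' k : ℕ, ∫⁻ x in (fun y : ℝ => (k + 1 + y)⁻¹) '' Ico (0 : ℝ) 1,
          g (gaussMap x) * ENNReal.ofReal (1 + x)⁻¹ := lintegral_iUnion_le _ _
    _ = ∑' k : ℕ, ∫⁻ y in Ico (0 : ℝ) 1,
          g y * ENNReal.ofReal ((k + 1 + y)⁻¹ * (k + 2 + y)⁻¹) := tsum_congr hpiece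
    _ = ∫⁻ y in Ico (0 : ℝ) 1,
          ∑' k : ℕ, g y * ENNReal.ofReal ((k + 1 + y)⁻¹ * (k + 2 + y)⁻¹) :=
        (lintegral_tsum fun k => by fun_prop).symm
    _ = ∫⁻ y in Ico (0 : ℝ) 1, g y * ENNReal.ofReal (1 + y)⁻¹ :=
        setLIntegral_congr_fun measurableSet_Ico fun y hy => by
          simp only [ENNReal.tsum_mul_left, tsum_ofReal_inv_mul_inv hy.1]
    _ = ∫⁻ x in Ioo (0 : ℝ) 1, g x * ENNReal.ofReal (1 + x)⁻¹ := by
        rw [Measure.restrict_congr_set Ioo_ae_eq_Ico]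

theorem lintegral_comp_gaussMap_iterate_mul_le {g : ℝ → ℝ≥0∞} (hg : Measurable g) (n : ℕ) :
    ∫⁻ x in Ioo (0 : ℝ) 1, g (gaussMap^[n] x) * ENNReal.ofReal (1 + x)⁻¹ ≤
      ∫⁻ x in Ioo (0 : ℝ) 1, g x * ENNReal.ofReal (1 + x)⁻¹ := by
  induction n with
  | zero => simp
  | succ n ih =>
    simp only [Function.iterate_succ_apply]
    exact (lintegral_comp_gaussMap_mul_le
      (hg.comp (measurable_gaussMap.iterate n))).trans ih

theorem lintegral_comp_gaussMap_iterate_le {g : ℝ → ℝ≥0∞} (hg : Measurable g) (n : ℕ) :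
    ∫⁻ x in Ioo (0 : ℝ) 1, g (gaussMap^[n] x) ≤ 2 * ∫⁻ x in Ioo (0 : ℝ) 1, g x := by
  calc ∫⁻ x in Ioo (0 : ℝ) 1, g (gaussMap^[n] x)
      ≤ ∫⁻ x in Ioo (0 : ℝ) 1, 2 * (g (gaussMap^[n] x) * ENNReal.ofReal (1 + x)⁻¹) := by
        refine setLIntegral_mono' measurableSet_Ioo fun x hx => ?_
        have h : 1 ≤ 2 * ENNReal.ofReal (1 + x)⁻¹ := by
          have h2 : (2 : ℝ≥0∞) = ENNReal.ofReal 2 := by simp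
          rw [h2, ← ENNReal.ofReal_mul (by norm_num), ENNReal.one_le_ofReal,
            ← div_eq_mul_inv, one_le_div (by linarith [hx.1])]
          linarith [hx.2]
        calc g (gaussMap^[n] x) = g (gaussMap^[n] x) * 1 := (mul_one _).symm
          _ ≤ g (gaussMap^[n] x) * (2 * ENNReal.ofReal (1 + x)⁻¹) := by gcongr
          _ = _ := by ring
    _ = 2 * ∫⁻ x in Ioo (0 : ℝ) 1, g (gaussMap^[n] x) * ENNReal.ofReal (1 + x)⁻¹ :=
        lintegral_const_mul' _ _ (by simp)
    _ ≤ 2 * ∫⁻ x in Ioo (0 : ℝ) 1, g x * ENNReal.ofReal (1 + x)⁻¹ := by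
        gcongr 2 * ?_
        exact lintegral_comp_gaussMap_iterate_mul_le hg n
    _ ≤ 2 * ∫⁻ x in Ioo (0 : ℝ) 1, g x := by
        gcongr 2 * ?_
        refine setLIntegral_mono' measurableSet_Ioo fun x hx => ?_
        refine mul_le_of_le_one_right' ?_
        rw [ENNReal.ofReal_le_one]
        exact inv_le_one_of_one_le₀ (by linarith [hx.1])

theorem lintegral_min_inv_le {N : ℝ} (hN : 1 ≤ N) :
    ∫⁻ x in Ioo (0 : ℝ) 1, ENNReal.ofReal (min x⁻¹ N) ≤ ENNReal.ofReal (1 + Real.log N) := by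
  have hN0 : 0 < N := by linarith
  have hlog : 0 ≤ Real.log N := Real.log_nonneg hN
  have hsub : Ioo (0 : ℝ) 1 ⊆ Ioc 0 N⁻¹ ∪ Ioc N⁻¹ 1 := by
    rintro x ⟨h0, h1⟩
    rcases le_or_gt x N⁻¹ with h | h
    · exact Or.inl ⟨h0, h⟩
    · exact Or.inr ⟨h, h1.le⟩
  have hinv : N⁻¹ ≤ 1 := inv_le_one_of_one_le₀ hN
  have hpos : 0 < N⁻¹ := inv_pos.2 hN0
  have hint : IntegrableOn (fun x : ℝ => x⁻¹) (Ioc N⁻¹ 1) := by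
    rw [← intervalIntegrable_iff_integrableOn_Ioc_of_le hinv]
    refine intervalIntegral.intervalIntegrable_inv (fun x hx => ?_) continuousOn_id
    rw [uIcc_of_le hinv] at hx
    exact (hpos.trans_le hx.1).ne'
  calc ∫⁻ x in Ioo (0 : ℝ) 1, ENNReal.ofReal (min x⁻¹ N)
      ≤ ∫⁻ x in Ioc 0 N⁻¹ ∪ Ioc N⁻¹ 1, ENNReal.ofReal (min x⁻¹ N) := lintegral_mono_set hsub
    _ ≤ (∫⁻ x in Ioc 0 N⁻¹, ENNReal.ofReal (min x⁻¹ N)) +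
          ∫⁻ x in Ioc N⁻¹ 1, ENNReal.ofReal (min x⁻¹ N) := lintegral_union_le _ _ _
    _ ≤ (∫⁻ _ in Ioc 0 N⁻¹, ENNReal.ofReal N) + ∫⁻ x in Ioc N⁻¹ 1, ENNReal.ofReal x⁻¹ := by
        gcongr
        · exact min_le_right _ _
        · exact min_le_left _ _
    _ = ENNReal.ofReal 1 + ENNReal.ofReal (Real.log N) := by
        congr 1
        · rw [setLIntegral_const, Real.volume_Ioc, ← ENNReal.ofReal_mul hN0.le, sub_zero,
            mul_inv_cancel₀ hN0.ne']
        · rw [← ofReal_integral_eq_lintegral_ofReal hint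
            ((ae_restrict_iff' measurableSet_Ioc).2 (ae_of_all _ fun x hx =>
              inv_nonneg.2 (hpos.trans hx.1).le)),
            ← intervalIntegral.integral_of_le hinv, integral_inv_of_pos hpos one_pos]
          simp
    _ = ENNReal.ofReal (1 + Real.log N) := (ENNReal.ofReal_add zero_le_one hlog).symm

theorem volume_gaussMap_iterate_lt_le {c : ℝ} (n : ℕ) :
    volume.restrict (Ioo (0 : ℝ) 1) {x | gaussMap^[n] x < c} ≤ 2 * ENNReal.ofReal c := by
  have hmeas : MeasurableSet {x | gaussMap^[n] x < c} :=
    measurable_gaussMap.iterate n measurableSet_Iio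
  have h := lintegral_comp_gaussMap_iterate_le
    (measurable_one.indicator (measurableSet_Iio (a := c)) : Measurable
      ((Iio c).indicator (1 : ℝ → ℝ≥0∞))) n
  have h1 : ∀ x, (Iio c).indicator (1 : ℝ → ℝ≥0∞) (gaussMap^[n] x) =
      {x | gaussMap^[n] x < c}.indicator 1 x := fun x => rfl
  simp only [h1] at h
  rw [lintegral_indicator_one hmeas, lintegral_indicator_one measurableSet_Iio] at h
  refine h.trans ?_
  gcongr
  rw [Measure.restrict_apply measurableSet_Iio]
  calc volume (Iio c ∩ Ioo (0 : ℝ) 1) ≤ volume (Ioo 0 c) :=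
        measure_mono fun x hx => ⟨hx.2.1, hx.1⟩
    _ = ENNReal.ofReal c := by simp

/-- `p n / q n` are the convergents, built from the partial quotients `k (n + 1)`, of a continued
fraction with value `ρ`. -/
structure IsContFrac (ρ : ℝ) (k : ℕ → ℕ) (p q : ℕ → ℝ) : Prop where
  one_le : ∀ n, 1 ≤ k (n + 1)
  p_zero : p 0 = 0
  p_one : p 1 = 1
  q_zero : q 0 = 1
  q_one : q 1 = k 1
  p_rec : ∀ n, p (n + 2) = k (n + 2) * p (n + 1) + p n
  q_rec : ∀ n, q (n + 2) = k (n + 2) * q (n + 1) + q n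
  tendsto : Tendsto (fun n => p n / q n) atTop (𝓝 ρ)

namespace IsContFrac

variable {ρ : ℝ} {k : ℕ → ℕ} {p q : ℕ → ℝ}

theorem p_nonneg_le_q (h : IsContFrac ρ k p q) (n : ℕ) :
    (0 ≤ p n ∧ p n ≤ q n) ∧ 1 ≤ p (n + 1) ∧ p (n + 1) ≤ q (n + 1) := by
  induction n with
  | zero =>
    have hk : (1 : ℝ) ≤ k 1 := by exact_mod_cast h.one_le 0
    simp [h.p_zero, h.p_one, h.q_zero, h.q_one, hk]
  | succ n ih =>
    obtain ⟨⟨h0, h1⟩, h2, h3⟩ := ih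
    have hk : (1 : ℝ) ≤ k (n + 2) := by exact_mod_cast h.one_le (n + 1)
    refine ⟨⟨by linarith, h3⟩, ?_, ?_⟩
    · rw [h.p_rec]
      nlinarith
    · rw [h.p_rec, h.q_rec]
      gcongr

theorem mem_Icc (h : IsContFrac ρ k p q) : ρ ∈ Icc (0 : ℝ) 1 := by
  refine isClosed_Icc.mem_of_tendsto h.tendsto (Eventually.of_forall fun n => ?_)
  obtain ⟨h0, h1⟩ := (h.p_nonneg_le_q n).1
  exact ⟨div_nonneg h0 (h0.trans h1), div_le_one_of_le₀ h1 (h0.trans h1)⟩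

theorem mem_Ioo (h : IsContFrac ρ k p q) (hρ : Irrational ρ) : ρ ∈ Ioo (0 : ℝ) 1 :=
  ⟨h.mem_Icc.1.lt_of_ne' hρ.ne_zero, h.mem_Icc.2.lt_of_ne hρ.ne_one⟩

theorem shift (h : IsContFrac ρ k p q) (hρ : ρ ≠ 0) :
    IsContFrac (ρ⁻¹ - k 1) (fun n => k (n + 1)) (fun n => q (n + 1) - k 1 * p (n + 1))
      (fun n => p (n + 1)) where
  one_le n := h.one_le (n + 1)
  p_zero := by simp [h.q_one, h.p_one]
  p_one := by
    simp only [h.p_rec, h.q_rec, zero_add, Nat.reduceAdd, h.p_one, h.q_one, h.p_zero, h.q_zero]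
    ring
  q_zero := h.p_one
  q_one := by simp [h.p_rec 0, h.p_zero, h.p_one]
  p_rec n := by
    rw [h.p_rec (n + 1), h.q_rec (n + 1)]
    ring
  q_rec n := h.p_rec (n + 1)
  tendsto := by
    have h1 := (((tendsto_add_atTop_iff_nat 1).2 h.tendsto).inv₀ hρ).sub_const (k 1 : ℝ)
    refine h1.congr fun n => ?_
    have h2 : p (n + 1) ≠ 0 := by linarith [(h.p_nonneg_le_q n).2.1]
    rw [inv_div, sub_div, mul_div_cancel_right₀ _ h2]

theorem gaussMap_eq (h : IsContFrac ρ k p q) (hρ : Irrational ρ) : gaussMap ρ = ρ⁻¹ - k 1 := by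
  have h1 := (h.shift hρ.ne_zero).mem_Ioo (hρ.inv.sub_natCast _)
  rw [gaussMap, ← Int.fract_sub_natCast _ (k 1), Int.fract_eq_self.2 ⟨h1.1.le, h1.2⟩]

theorem natCast_le_inv_gaussMap_iterate (h : IsContFrac ρ k p q) (hρ : Irrational ρ) (n : ℕ) :
    0 < gaussMap^[n] ρ ∧ (k (n + 1) : ℝ) ≤ (gaussMap^[n] ρ)⁻¹ := by
  induction n generalizing ρ k p q with
  | zero => exact ⟨(h.mem_Ioo hρ).1, sub_nonneg.1 (h.shift hρ.ne_zero).mem_Icc.1⟩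
  | succ n ih =>
    rw [Function.iterate_succ_apply, h.gaussMap_eq hρ]
    exact ih (h.shift hρ.ne_zero) (hρ.inv.sub_natCast _)

end IsContFrac

theorem summable_mul_one_add_log_sq {K : ℕ → ℝ} (hK : ∀ n, 0 ≤ K n)
    (hsum : Summable fun n : ℕ => K (n + 1) * Real.log (n + 1)) :
    Summable fun n : ℕ => K (n + 1) * (1 + Real.log (((n : ℝ) + 2) ^ 2)) := by
  rw [← summable_nat_add_iff 1]
  refine Summable.of_nonneg_of_le (fun n => ?_) (fun n => ?_)
    (((summable_nat_add_iff 1).2 hsum).mul_left 6)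
  · have : 0 ≤ Real.log ((((n + 1 : ℕ) : ℝ) + 2) ^ 2) :=
      Real.log_nonneg (one_le_pow₀ (by push_cast; linarith [n.cast_nonneg (α := ℝ)]))
    exact mul_nonneg (hK _) (by linarith)
  · have hn : (0 : ℝ) ≤ n := n.cast_nonneg
    have h1 : Real.log 2 ≤ Real.log ((n + 1 : ℕ) + 1) :=
      Real.log_le_log (by norm_num) (by push_cast; linarith)
    have h2 : Real.log ((n + 1 : ℕ) + 2) ≤ 2 * Real.log ((n + 1 : ℕ) + 1) := by
      rw [← Nat.cast_ofNat (R := ℝ) (n := 2), ← Real.log_pow]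
      exact Real.log_le_log (by positivity) (by push_cast; nlinarith)
    have h3 := Real.log_two_gt_d9
    rw [mul_left_comm, Real.log_pow]
    refine mul_le_mul_of_nonneg_left ?_ (hK _)
    push_cast at *
    linarith

theorem ae_eventually_le_gaussMap_iterate :
    ∀ᵐ ρ ∂(volume.restrict (Ioo (0 : ℝ) 1)),
      ∀ᶠ n : ℕ in atTop, (((n : ℝ) + 2) ^ 2)⁻¹ ≤ gaussMap^[n] ρ := by
  have hs : Summable fun n : ℕ => (((n : ℝ) + 2) ^ 2)⁻¹ := by
    have := (summable_nat_add_iff 2).2 (Real.summable_nat_pow_inv.2 one_lt_two)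
    exact_mod_cast this
  have hfin : ∑' n : ℕ, volume.restrict (Ioo (0 : ℝ) 1)
      {x | gaussMap^[n] x < (((n : ℝ) + 2) ^ 2)⁻¹} ≠ ∞ := by
    refine ne_top_of_le_ne_top ?_ (ENNReal.tsum_le_tsum fun n =>
      volume_gaussMap_iterate_lt_le n)
    rw [ENNReal.tsum_mul_left]
    exact ENNReal.mul_ne_top (by simp) hs.tsum_ofReal_ne_top
  filter_upwards [ae_eventually_notMem hfin] with ρ hρ
  filter_upwards [hρ] with n hn
  exact not_lt.1 hn

theorem ae_summable_mul_min_inv_gaussMap_iterate {K : ℕ → ℝ} (hK : ∀ n, 0 ≤ K n)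
    (hsum : Summable fun n : ℕ => K (n + 1) * Real.log (n + 1)) :
    ∀ᵐ ρ ∂(volume.restrict (Ioo (0 : ℝ) 1)),
      ∑' n : ℕ, ENNReal.ofReal (K (n + 1)) *
        ENNReal.ofReal (min (gaussMap^[n] ρ)⁻¹ (((n : ℝ) + 2) ^ 2)) < ∞ := by
  have hT : ∀ n : ℕ, Measurable gaussMap^[n] := fun n => measurable_gaussMap.iterate n
  have hmeas : ∀ n : ℕ, Measurable fun ρ => ENNReal.ofReal (K (n + 1)) *
      ENNReal.ofReal (min (gaussMap^[n] ρ)⁻¹ (((n : ℝ) + 2) ^ 2)) := fun n =>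
    (((hT n).inv.min measurable_const).ennreal_ofReal).const_mul _
  refine ae_lt_top (Measurable.tsum hmeas) ?_
  rw [lintegral_tsum fun n => (hmeas n).aemeasurable]
  refine ne_top_of_le_ne_top (ENNReal.mul_ne_top (a := 2) (by simp)
    (summable_mul_one_add_log_sq hK hsum).tsum_ofReal_ne_top) ?_
  rw [← ENNReal.tsum_mul_left]
  refine ENNReal.tsum_le_tsum fun n => ?_
  rw [lintegral_const_mul' _ _ ENNReal.ofReal_ne_top, ENNReal.ofReal_mul (hK _), mul_left_comm]
  gcongr
  refine (lintegral_comp_gaussMap_iterate_le (g := fun x =>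
    ENNReal.ofReal (min x⁻¹ (((n : ℝ) + 2) ^ 2)))
    (measurable_inv.min measurable_const).ennreal_ofReal n).trans ?_
  gcongr
  exact lintegral_min_inv_le (one_le_pow₀ (by linarith [n.cast_nonneg (α := ℝ)]))

theorem ae_irrational : ∀ᵐ ρ : ℝ, Irrational ρ :=
  (countable_range ((↑) : ℚ → ℝ)).ae_notMem volume


/-- If `Σ_{n≥1} Kₙ log n < ∞`, then for Lebesgue-almost every `ρ ∈ (0,1)` the
series `Σ_{n≥1} kₙ(ρ) Kₙ` converges, where `kₙ(ρ)` are the partial quotients of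
the continued fraction expansion of `ρ` (characterized below by the convergent
recurrences together with `pₙ/qₙ → ρ`). -/
theorem summable_partial_quotients_ae
    (K : ℕ → ℝ) (hK : ∀ n, 0 ≤ K n)
    (hsum : Summable fun n : ℕ => K (n + 1) * Real.log (n + 1)) :
    ∀ᵐ ρ ∂(MeasureTheory.volume.restrict (Set.Ioo (0:ℝ) 1)),
      ∀ k p q : ℕ → ℕ,
        (∀ n, 1 ≤ k (n + 1)) →
        p 0 = 0 → p 1 = 1 → q 0 = 1 → q 1 = k 1 →
        (∀ n, p (n + 2) = k (n + 2) * p (n + 1) + p n) →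
        (∀ n, q (n + 2) = k (n + 2) * q (n + 1) + q n) →
        Filter.Tendsto (fun n => (p n : ℝ) / (q n : ℝ)) Filter.atTop (nhds ρ) →
        Summable (fun n : ℕ => (k (n + 1) : ℝ) * K (n + 1)) := by
  filter_upwards [ae_restrict_of_ae ae_irrational, ae_eventually_le_gaussMap_iterate,
    ae_summable_mul_min_inv_gaussMap_iterate hK hsum]
    with ρ hirr hev hfin k p q hk hp0 hp1 hq0 hq1 hp hq hlim
  have hcf : IsContFrac ρ k (fun n => (p n : ℝ)) (fun n => (q n : ℝ)) :=
    { one_le := hk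
      p_zero := by simp [hp0]
      p_one := by simp [hp1]
      q_zero := by simp [hq0]
      q_one := by simp [hq1]
      p_rec := fun n => by simp [hp]
      q_rec := fun n => by simp [hq]
      tendsto := hlim }
  have hkle := hcf.natCast_le_inv_gaussMap_iterate hirr
  have hmin0 : ∀ n : ℕ, 0 ≤ min (gaussMap^[n] ρ)⁻¹ (((n : ℝ) + 2) ^ 2) := fun n =>
    le_min (inv_nonneg.2 (hkle n).1.le) (by positivity)
  have hs : Summable fun n : ℕ =>
      K (n + 1) * min (gaussMap^[n] ρ)⁻¹ (((n : ℝ) + 2) ^ 2) := by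
    refine (ENNReal.summable_toReal hfin.ne).congr fun n => ?_
    rw [← ENNReal.ofReal_mul (hK _), ENNReal.toReal_ofReal (mul_nonneg (hK _) (hmin0 n))]
  refine Summable.of_norm_bounded_eventually_nat hs ?_
  filter_upwards [hev] with n hn
  rw [Real.norm_of_nonneg (mul_nonneg (Nat.cast_nonneg _) (hK _)), mul_comm]
  refine mul_le_mul_of_nonneg_left (le_min (hkle n).2 ((hkle n).2.trans ?_)) (hK _)
  exact inv_le_of_inv_le₀ (by positivity) hn
end
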